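/- The only OADP curves are the rational normal cubic curves in ℙ^3. -/

import Mathlib

/-!
Basic vocabulary of complex projective algebraic geometry, built on
`Projectivization ℂ (Fin (r+1) → ℂ)` and homogeneous multivariate polynomials.
-/

noncomputable section

open MvPolynomial

/-- Complex projective `r`-space. -/
abbrev Pt (r : ℕ) : Type := Projectivization ℂ (Fin (r + 1) → ℂ)

namespace ProjGeo

variable {r s : ℕ}

/-- A (homogeneous) polynomial vanishes at a point of projective space. -/
def VanishesAt (p : MvPolynomial (Fin (r + 1)) ℂ) (x : Pt r) : Prop :=
  ∀ (v : Fin (r + 1) → ℂ) (hv : v ≠ 0), Projectivization.mk ℂ v hv = x → eval v p = 0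

/-- Common zero locus of a family of polynomials. -/
def ZeroLocus (S : Set (MvPolynomial (Fin (r + 1)) ℂ)) : Set (Pt r) :=
  {x | ∀ p ∈ S, VanishesAt p x}

/-- A subset of projective space is algebraic (Zariski closed) if it is the common
zero locus of a set of homogeneous polynomials. -/
def IsAlgSet (X : Set (Pt r)) : Prop :=
  ∃ S : Set (MvPolynomial (Fin (r + 1)) ℂ),
    (∀ p ∈ S, ∃ d, p.IsHomogeneous d) ∧ X = ZeroLocus S

/-- Zariski closure. -/
def zcl (A : Set (Pt r)) : Set (Pt r) := ⋂₀ {Y | IsAlgSet Y ∧ A ⊆ Y}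

/-- An irreducible (projective) variety: a nonempty algebraic set which is not
contained in the union of two algebraic sets unless it is contained in one of them. -/
def IsIrrVar (X : Set (Pt r)) : Prop :=
  X.Nonempty ∧ IsAlgSet X ∧
    ∀ Y Z : Set (Pt r), IsAlgSet Y → IsAlgSet Z → X ⊆ Y ∪ Z → X ⊆ Y ∨ X ⊆ Z

/-- `DimGE X n` : `X` has dimension at least `n`, measured by chains of irreducible
subvarieties of length `n+1`. -/
def DimGE (X : Set (Pt r)) (n : ℕ) : Prop :=
  ∃ c : Fin (n + 1) → Set (Pt r),
    (∀ i, IsIrrVar (c i) ∧ c i ⊆ X) ∧ ∀ i j : Fin (n + 1), i < j → c i ⊂ c j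

/-- `X` has dimension exactly `n`. -/
def HasDim (X : Set (Pt r)) (n : ℕ) : Prop := DimGE X n ∧ ¬ DimGE X (n + 1)

/-- Local dimension at a point is at least `n`. -/
def DimGEAt (X : Set (Pt r)) (x : Pt r) (n : ℕ) : Prop :=
  ∃ c : Fin (n + 1) → Set (Pt r),
    (∀ i, IsIrrVar (c i) ∧ c i ⊆ X) ∧ x ∈ c 0 ∧ ∀ i j : Fin (n + 1), i < j → c i ⊂ c j

/-- The linear subspace of projective space associated to a linear subspace `W`. -/
def projSub (W : Submodule ℂ (Fin (r + 1) → ℂ)) : Set (Pt r) :=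
  {x | x.submodule ≤ W}

/-- The linear span of a set of points. -/
def projSpan (A : Set (Pt r)) : Submodule ℂ (Fin (r + 1) → ℂ) :=
  ⨆ x ∈ A, x.submodule

/-- Non-degenerate: not contained in any hyperplane. -/
def Nondeg (X : Set (Pt r)) : Prop := projSpan X = ⊤

/-- A property `Q` holds at the general point of `X` : it holds away from some
algebraic set not containing `X`. -/
def Generic (X : Set (Pt r)) (Q : Pt r → Prop) : Prop :=
  ∃ A : Set (Pt r), IsAlgSet A ∧ ¬ X ⊆ A ∧ ∀ x ∈ X \ A, Q x

/-- The line through two (distinct) points. -/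
def lineThrough (x y : Pt r) : Set (Pt r) :=
  projSub (x.submodule ⊔ y.submodule)

/-- `L` is a (proper) secant line of `X`. -/
def SecLine (X : Set (Pt r)) (L : Set (Pt r)) : Prop :=
  ∃ x ∈ X, ∃ y ∈ X, x ≠ y ∧ L = lineThrough x y

/-- The secant variety: Zariski closure of the union of all secant lines. -/
def SecVar (X : Set (Pt r)) : Set (Pt r) :=
  zcl {p | ∃ L, SecLine X L ∧ p ∈ L}

/-- An irreducible, non-degenerate projective variety of dimension `n`. -/
def IsVariety (n : ℕ) (X : Set (Pt r)) : Prop :=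
  IsIrrVar X ∧ HasDim X n ∧ Nondeg X

/-- A variety with one apparent double point: an irreducible non-degenerate,
non secant defective variety `X ⊆ ℙ^{2n+1}` of dimension `n` such that through the
general point of `ℙ^{2n+1}` there passes exactly one secant line of `X`. -/
def IsOADP (n : ℕ) (X : Set (Pt (2 * n + 1))) : Prop :=
  IsVariety n X ∧ SecVar X = Set.univ ∧
    Generic Set.univ (fun p => ∃! L : Set (Pt (2 * n + 1)), SecLine X L ∧ p ∈ L)

/-- Projective equivalence of two subsets of the same projective space. -/
def ProjEquiv (X Y : Set (Pt r)) : Prop :=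
  ∃ g : (Fin (r + 1) → ℂ) ≃ₗ[ℂ] (Fin (r + 1) → ℂ),
    Y = Projectivization.map (g : (Fin (r + 1) → ℂ) →ₗ[ℂ] (Fin (r + 1) → ℂ)) g.injective '' X

end ProjGeo

/-!
STATEMENT 2: The only OADP curves are the rational normal cubic curves in `ℙ^3`.
-/

namespace ProjGeo

/-- The standard rational normal cubic (twisted cubic) curve in `ℙ^3`. -/
def stdTwistedCubic : Set (Pt 3) :=
  zcl {p | ∃ s t : ℂ, ∃ h : (![s ^ 3, s ^ 2 * t, s * t ^ 2, t ^ 3] : Fin 4 → ℂ) ≠ 0,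
    p = Projectivization.mk ℂ ![s ^ 3, s ^ 2 * t, s * t ^ 2, t ^ 3] h}

/-- A rational normal cubic curve in `ℙ^3` is a curve projectively equivalent to the
standard twisted cubic. -/
def IsRationalNormalCubic (X : Set (Pt 3)) : Prop :=
  ProjEquiv X stdTwistedCubic

lemma exists_derivation (K L : Type) [Field K] [Field L] [Algebra K L] [CharZero K] [CharZero L] (t : L)
    (ht : Transcendental K t) : ∃ D : Derivation K L L, D t ≠ 0 := by
  classical
  have h1 : AlgebraicIndepOn K id ({t} : Set L) := by
    rw [AlgebraicIndepOn]
    exact (algebraicIndependent_unique_type_iff).2 (by simpa using ht)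
  obtain ⟨B, hB, hb⟩ := exists_isTranscendenceBasis_superset h1
  let tb : B := ⟨t, hB rfl⟩
  let : Algebra (MvPolynomial B K) L := (aeval (R := K) (fun b : B => (b : L))).toAlgebra
  have : IsScalarTower K (MvPolynomial B K) L := IsScalarTower.of_algebraMap_eq' (by
    ext x; simp [RingHom.algebraMap_toAlgebra])
  have hinj : Function.Injective (algebraMap (MvPolynomial B K) L) := hb.1
  have : FaithfulSMul (MvPolynomial B K) L := (faithfulSMul_iff_algebraMap_injective _ _).2 hinj
  let : Algebra (FractionRing (MvPolynomial B K)) L := FractionRing.liftAlgebra _ _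
  have : IsScalarTower (MvPolynomial B K) (FractionRing (MvPolynomial B K)) L := inferInstance
  have halg : Algebra.IsAlgebraic (MvPolynomial B K) L := by
    have := hb.isAlgebraic
    refine Algebra.IsAlgebraic.of_ringHom_of_comp_eq (S := Algebra.adjoin K (Set.range ((↑) : B → L)))
      (B := L) hb.1.aevalEquiv.toRingEquiv (RingHom.id L) (EquivLike.surjective _) (fun _ _ h => h) ?_
    ext x <;> simp [RingHom.algebraMap_toAlgebra]
  have : Algebra.IsAlgebraic (FractionRing (MvPolynomial B K)) L := by
    exact Algebra.IsAlgebraic.extendScalars (R := MvPolynomial B K) (IsFractionRing.injective _ _)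
  have : CharZero (FractionRing (MvPolynomial B K)) := by
    exact charZero_of_injective_algebraMap (R := MvPolynomial B K) (IsFractionRing.injective _ _)
  have : Algebra.FormallyEtale (FractionRing (MvPolynomial B K)) L := Algebra.FormallyEtale.of_isSeparable _ L
  have : Algebra.FormallyEtale (MvPolynomial B K) (FractionRing (MvPolynomial B K)) := 
    Algebra.FormallyEtale.of_isLocalization (nonZeroDivisors _)
  have : Algebra.FormallyEtale (MvPolynomial B K) L := Algebra.FormallyEtale.comp _ (FractionRing (MvPolynomial B K)) L
  let e := KaehlerDifferential.tensorKaehlerEquivOfFormallyEtale K (MvPolynomial B K) L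
  let b := (KaehlerDifferential.mvPolynomialBasis K B).baseChange L
  let f : Ω[L⁄K] →ₗ[L] L := (b.coord tb) ∘ₗ e.symm.toLinearMap
  refine ⟨f.compDer (KaehlerDifferential.D K L), ?_⟩
  have h2 : algebraMap (MvPolynomial B K) L (X tb) = t := by simp [RingHom.algebraMap_toAlgebra, tb]
  have h3 : e.symm (KaehlerDifferential.D K L t) = b tb := by
    conv_lhs => rw [← h2]
    rw [KaehlerDifferential.tensorKaehlerEquivOfFormallyEtale_symm_D_algebraMap]
    simp [b]
  simp [f, h3]

open AlgebraicIndependent in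
/-- relative algebraic closure in `ℂ` of the field generated by a set. -/
def acl (S : Set ℂ) : Subfield ℂ where
  carrier := {z | IsAlgebraic (Algebra.adjoin ℚ S) z}
  mul_mem' := fun ha hb => IsAlgebraic.mul ha hb
  one_mem' := isAlgebraic_one
  add_mem' := fun ha hb => IsAlgebraic.add ha hb
  zero_mem' := isAlgebraic_zero
  neg_mem' := fun ha => IsAlgebraic.neg ha
  inv_mem' := fun _ ha => IsAlgebraic.inv ha

lemma mem_acl {S : Set ℂ} {z : ℂ} : z ∈ acl S ↔ IsAlgebraic (Algebra.adjoin ℚ S) z := Iff.rfl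

lemma mem_acl_iff {S : Set ℂ} {z : ℂ} :
    z ∈ acl S ↔ z ∈ (AlgebraicIndependent.matroid ℚ ℂ).closure S := by
  rw [AlgebraicIndependent.matroid_closure_eq]; rfl

lemma subset_acl (S : Set ℂ) : S ⊆ acl S := fun z hz => 
  mem_acl_iff.2 (Matroid.subset_closure _ S (by simp) hz)

lemma acl_le {S T : Set ℂ} (h : S ⊆ acl T) : acl S ≤ acl T := by
  intro z hz
  rw [mem_acl_iff] at *
  exact (Matroid.closure_subset_closure_of_subset_closure (fun s hs => mem_acl_iff.1 (h hs))) hz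

lemma acl_mono {S T : Set ℂ} (h : S ⊆ T) : acl S ≤ acl T := acl_le (h.trans (subset_acl T))

lemma acl_exchange {S : Set ℂ} {z u : ℂ} (h : z ∈ acl (insert u S)) (h' : z ∉ acl S) :
    u ∈ acl (insert z S) := by
  rw [mem_acl_iff] at *
  exact (Matroid.closure_exchange ⟨h, h'⟩).1

lemma acl_countable {S : Set ℂ} (h : S.Countable) : (acl S : Set ℂ).Countable := by
  have : Countable (Algebra.adjoin ℚ S) := by
    have : Countable S := h.to_subtype
    rw [Algebra.adjoin_eq_range]
    have : Countable (MvPolynomial S ℚ) := by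
      rw [← Cardinal.mk_le_aleph0_iff]
      refine MvPolynomial.cardinalMk_le_max.trans ?_
      simp [Cardinal.mk_le_aleph0_iff, this]
    exact (Set.countable_range _).to_subtype
  exact Algebraic.countable (Algebra.adjoin ℚ S) ℂ

lemma mem_acl_of_isAlgebraic {S : Set ℂ} {z : ℂ} (h : IsAlgebraic (acl S) z) : z ∈ acl S := by
  have h2 : Algebra.adjoin ℚ S ≤ Algebra.adjoin ℚ (acl S : Set ℂ) := Algebra.adjoin_mono (subset_acl S)
  have : z ∈ acl (acl S : Set ℂ) := by
    refine IsAlgebraic.ringHom_of_comp_eq (R := acl S) (A := ℂ) (a := z)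
      (({ toFun := fun x => ⟨x.1, Algebra.subset_adjoin x.2⟩, map_one' := rfl, map_mul' := fun _ _ => rfl, map_zero' := rfl, map_add' := fun _ _ => rfl } : acl S →+* Algebra.adjoin ℚ (acl S : Set ℂ)))
      (RingHom.id ℂ) h ?_ ?_
    · intro a b hab
      exact Subtype.ext (congrArg (fun t : Algebra.adjoin ℚ (acl S : Set ℂ) => (t : ℂ)) hab)
    · rfl
  exact acl_le (fun _ h => h) this

lemma transcendental_acl {S : Set ℂ} {z : ℂ} (h : z ∉ acl S) : Transcendental (acl S) z :=
  fun hz => h (mem_acl_of_isAlgebraic hz)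

instance isAlgClosed_acl (S : Set ℂ) : IsAlgClosed (acl S) := by
  refine IsAlgClosed.of_exists_root _ fun p hp hi => ?_
  obtain ⟨z, hz⟩ := IsAlgClosed.exists_aeval_eq_zero ℂ p (by
    exact (Polynomial.degree_pos_of_irreducible hi).ne')
  have hz' : z ∈ acl S := mem_acl_of_isAlgebraic ⟨p, hi.ne_zero, hz⟩
  refine ⟨⟨z, hz'⟩, ?_⟩
  apply Subtype.ext
  have : Polynomial.aeval (algebraMap (acl S) ℂ ⟨z, hz'⟩) p = 0 := hz
  rw [Polynomial.aeval_algebraMap_apply] at this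
  simpa using this

lemma exists_der {S : Set ℂ} {t : ℂ} (h : t ∉ acl S) : ∃ D : Derivation (acl S) ℂ ℂ, D t ≠ 0 :=
  exists_derivation _ _ _ (transcendental_acl h)

lemma der_acl {S T : Set ℂ} (D : Derivation (acl S) ℂ ℂ) (hT : ∀ z ∈ T, D z = 0) {z : ℂ} (hz : z ∈ acl T) :
    D z = 0 := by
  have hA : ∀ a ∈ Algebra.adjoin ℚ T, D a = 0 := by
    intro a ha
    induction ha using Algebra.adjoin_induction with
    | mem x hx => exact hT x hx
    | algebraMap r => 
      have : algebraMap ℚ ℂ r = algebraMap (acl S) ℂ (r : acl S) := by simp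
      rw [this, D.map_algebraMap]
    | add x y _ _ hx hy => simp [hx, hy]
    | mul x y _ _ hx hy => simp [hx, hy]
  let D' : Derivation (Algebra.adjoin ℚ T) ℂ ℂ := 
    { toFun := D, map_add' := by simp, map_smul' := by
        intro a z; change D ((a : ℂ) * z) = (a : ℂ) * D z
        simp [hA a a.2]
      map_one_eq_zero' := by simp
      leibniz' := by intro a b; simp }
  obtain ⟨p, hp, hpz⟩ := (mem_acl.1 hz)
  -- minimal degree
  classical
  let P : ℕ → Prop := fun n => ∃ p : Polynomial (Algebra.adjoin ℚ T), p ≠ 0 ∧ Polynomial.aeval z p = 0 ∧ p.natDegree = n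
  have hP : ∃ n, P n := ⟨_, p, hp, hpz, rfl⟩
  obtain ⟨q, hq, hqz, hqn⟩ := Nat.find_spec hP
  have hmin : ∀ r : Polynomial (Algebra.adjoin ℚ T), r ≠ 0 → Polynomial.aeval z r = 0 → q.natDegree ≤ r.natDegree := by
    intro r hr hrz
    rw [hqn]; exact Nat.find_min' hP ⟨r, hr, hrz, rfl⟩
  have hqd : q.natDegree ≠ 0 := by
    intro h0
    rw [Polynomial.eq_C_of_natDegree_eq_zero h0] at hqz hq
    simp at hqz hq
    exact hq hqz
  have hder : Polynomial.aeval z q.derivative ≠ 0 := by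
    intro h0
    have := hmin _ (by
      intro h; exact hqd (Polynomial.natDegree_eq_zero_of_derivative_eq_zero h)) h0
    have := Polynomial.natDegree_derivative_lt hqd
    omega
  have h3 : D' (Polynomial.aeval z q) = Polynomial.aeval z q.derivative • D' z := by
    exact Derivation.map_aeval D' q z
  rw [hqz] at h3
  simp at h3
  exact h3.resolve_left hder


section AlgSets
variable {r : ℕ}

lemma smul_rep {v w : Fin (r+1) → ℂ} (hv : v ≠ 0) (hw : w ≠ 0)
    (h : Projectivization.mk ℂ v hv = Projectivization.mk ℂ w hw) : ∃ a : ℂ, a ≠ 0 ∧ v = a • w := by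
  rw [Projectivization.mk_eq_mk_iff] at h
  obtain ⟨a, ha⟩ := h
  exact ⟨a, a.ne_zero, ha.symm⟩

lemma vanishesAt_mk {p : MvPolynomial (Fin (r+1)) ℂ} {v : Fin (r+1) → ℂ} (hv : v ≠ 0) :
    VanishesAt p (Projectivization.mk ℂ v hv) ↔ ∀ a : ℂ, a ≠ 0 → eval (a • v) p = 0 := by
  constructor
  · intro h a ha
    refine h (a • v) (smul_ne_zero ha hv) ?_
    rw [Projectivization.mk_eq_mk_iff]
    exact ⟨Units.mk0 a ha, rfl⟩
  · intro h w hw hwv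
    obtain ⟨a, ha, rfl⟩ := smul_rep hw hv hwv
    exact h a ha

lemma eval_smul_hom {p : MvPolynomial (Fin (r+1)) ℂ} {d : ℕ} (hp : p.IsHomogeneous d)
    (a : ℂ) (v : Fin (r+1) → ℂ) : eval (a • v) p = a ^ d * eval v p := by
  rw [eval_eq', eval_eq', Finset.mul_sum]
  refine Finset.sum_congr rfl fun m hm => ?_
  have hd : ∑ i, m i = d := by
    have := hp (mem_support_iff.1 hm)
    rw [← this, Finsupp.weight_apply, Finsupp.sum_fintype] <;> simp
  simp only [Pi.smul_apply, smul_eq_mul, mul_pow, Finset.prod_mul_distrib, Finset.prod_pow_eq_pow_sum, hd]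
  ring

lemma vanishesAt_mk_hom {p : MvPolynomial (Fin (r+1)) ℂ} {d : ℕ} (hp : p.IsHomogeneous d)
    {v : Fin (r+1) → ℂ} (hv : v ≠ 0) :
    VanishesAt p (Projectivization.mk ℂ v hv) ↔ eval v p = 0 := by
  rw [vanishesAt_mk]
  constructor
  · intro h; simpa using h 1 one_ne_zero
  · intro h a _; rw [eval_smul_hom hp, h, mul_zero]

/-- the vanishing of an arbitrary polynomial at all representatives defines an algebraic set -/
lemma isAlgSet_vanishes (G : MvPolynomial (Fin (r+1)) ℂ) : IsAlgSet {x : Pt r | VanishesAt G x} := by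
  refine ⟨{p | ∃ i, p = homogeneousComponent i G}, ?_, ?_⟩
  · rintro p ⟨i, rfl⟩; exact ⟨i, homogeneousComponent_isHomogeneous _ _⟩
  · ext x
    induction x using Projectivization.ind with | h v hv => 
    simp only [Set.mem_setOf_eq, ZeroLocus, forall_exists_index, forall_eq_apply_imp_iff]
    have key : ∀ a : ℂ, eval (a • v) G = ∑ i ∈ Finset.range (G.totalDegree + 1), a ^ i * eval v (homogeneousComponent i G) := by
      intro a
      conv_lhs => rw [← sum_homogeneousComponent G]
      rw [map_sum]
      exact Finset.sum_congr rfl fun i _ => eval_smul_hom (homogeneousComponent_isHomogeneous _ _) _ _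
    constructor
    · intro h i
      rw [vanishesAt_mk_hom (homogeneousComponent_isHomogeneous _ _)]
      rw [vanishesAt_mk] at h
      by_cases hi : i ≤ G.totalDegree
      swap
      · rw [homogeneousComponent_eq_zero _ _ (not_le.1 hi), map_zero]
      let P : Polynomial ℂ := ∑ i ∈ Finset.range (G.totalDegree + 1), Polynomial.C (eval v (homogeneousComponent i G)) * Polynomial.X ^ i
      have hP : P = 0 := by
        refine Polynomial.eq_zero_of_infinite_isRoot P ?_
        refine Set.Infinite.mono (s := {0}ᶜ) ?_ (Set.Finite.infinite_compl (Set.finite_singleton _))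
        intro a ha
        have := h a ha
        rw [key] at this
        simp only [Set.mem_setOf_eq, Polynomial.IsRoot.def, P, Polynomial.eval_finset_sum]
        rw [← this]
        refine Finset.sum_congr rfl fun i _ => ?_
        rw [Polynomial.eval_mul, Polynomial.eval_C, Polynomial.eval_pow, Polynomial.eval_X, mul_comm]
      have := congrArg (fun Q => Polynomial.coeff Q i) hP
      simp only [P, Polynomial.finset_sum_coeff, Polynomial.coeff_C_mul, Polynomial.coeff_X_pow, mul_ite, mul_one, mul_zero,
        Finset.sum_ite_eq, Polynomial.coeff_zero] at this
      rwa [if_pos (Finset.mem_range.2 (Nat.lt_succ_of_le hi))] at this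
    · intro h
      rw [vanishesAt_mk]
      intro a ha
      rw [key]
      refine Finset.sum_eq_zero fun i _ => ?_
      rw [(vanishesAt_mk_hom (homogeneousComponent_isHomogeneous _ _) hv).1 (h i), mul_zero]

lemma IsAlgSet.inter {Y Z : Set (Pt r)} (hY : IsAlgSet Y) (hZ : IsAlgSet Z) : IsAlgSet (Y ∩ Z) := by
  obtain ⟨S, hS, rfl⟩ := hY
  obtain ⟨T, hT, rfl⟩ := hZ
  refine ⟨S ∪ T, ?_, ?_⟩
  · rintro p (hp | hp); exacts [hS p hp, hT p hp]
  · ext x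
    simp only [ZeroLocus, Set.mem_inter_iff, Set.mem_setOf_eq, Set.mem_union]
    constructor
    · rintro ⟨h1, h2⟩ p (hp | hp); exacts [h1 p hp, h2 p hp]
    · intro h; exact ⟨fun p hp => h p (Or.inl hp), fun p hp => h p (Or.inr hp)⟩

lemma IsAlgSet.union {Y Z : Set (Pt r)} (hY : IsAlgSet Y) (hZ : IsAlgSet Z) : IsAlgSet (Y ∪ Z) := by
  obtain ⟨S, hS, rfl⟩ := hY
  obtain ⟨T, hT, rfl⟩ := hZ
  refine ⟨{q | ∃ p ∈ S, ∃ p' ∈ T, q = p * p'}, ?_, ?_⟩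
  · rintro q ⟨p, hp, p', hp', rfl⟩
    obtain ⟨d, hd⟩ := hS p hp
    obtain ⟨e, he⟩ := hT p' hp'
    exact ⟨_, hd.mul he⟩
  · ext x
    induction x using Projectivization.ind with | h v hv => 
    simp only [ZeroLocus, Set.mem_union, Set.mem_setOf_eq]
    constructor
    · rintro (h | h) q ⟨p, hp, p', hp', rfl⟩ w hw hwv
      · rw [map_mul, h p hp w hw hwv, zero_mul]
      · rw [map_mul, h p' hp' w hw hwv, mul_zero]
    · intro h
      by_contra hcon
      push Not at hcon
      obtain ⟨⟨p, hp, h1⟩, ⟨p', hp', h2⟩⟩ := hcon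
      obtain ⟨d, hd⟩ := hS p hp
      obtain ⟨e, he⟩ := hT p' hp'
      have := h _ ⟨p, hp, p', hp', rfl⟩
      rw [vanishesAt_mk_hom (hd.mul he), map_mul] at this
      rw [vanishesAt_mk_hom hd] at h1
      rw [vanishesAt_mk_hom he] at h2
      exact (mul_ne_zero h1 h2) this

lemma isAlgSet_singleton (x : Pt r) : IsAlgSet {x} := by
  induction x using Projectivization.ind with | h w hw => 
  refine ⟨{q | ∃ i j, q = C (w i) * X j - C (w j) * X i}, ?_, ?_⟩
  · rintro q ⟨i, j, rfl⟩
    refine ⟨1, ?_⟩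
    exact ((isHomogeneous_C_mul_X _ _)).sub (isHomogeneous_C_mul_X _ _)
  · ext x
    induction x using Projectivization.ind with | h v hv => 
    simp only [Set.mem_singleton_iff, ZeroLocus, Set.mem_setOf_eq]
    constructor
    · rintro h q ⟨i, j, rfl⟩ u hu huv
      rw [h] at huv
      obtain ⟨a, ha, rfl⟩ := smul_rep hu hw huv
      simp; ring
    · intro h
      have h1 : ∀ i j, w i * v j = w j * v i := by
        intro i j
        have := h _ ⟨i, j, rfl⟩ v hv rfl
        simpa [sub_eq_zero] using this
      obtain ⟨i, hi⟩ := Function.ne_iff.1 hw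
      simp only [Pi.zero_apply] at hi
      have h2 : v = (v i / w i) • w := by
        ext j
        have := h1 i j
        simp; field_simp; linear_combination this
      have h3 : v i / w i ≠ 0 := by
        intro h0; rw [h0, zero_smul] at h2; exact hv h2
      rw [Projectivization.mk_eq_mk_iff]
      exact ⟨Units.mk0 _ h3, h2.symm⟩

lemma isAlgSet_empty : IsAlgSet (∅ : Set (Pt r)) := by
  refine ⟨{1}, ?_, ?_⟩
  · rintro p rfl; exact ⟨0, isHomogeneous_one _ _⟩
  · ext x
    induction x using Projectivization.ind with | h v hv => 
    simp only [Set.mem_empty_iff_false, ZeroLocus, Set.mem_setOf_eq, Set.mem_singleton_iff, forall_eq, false_iff]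
    intro h
    simpa using h v hv rfl

lemma isAlgSet_finite {Y : Set (Pt r)} (h : Y.Finite) : IsAlgSet Y := by
  induction Y, h using Set.Finite.induction_on with
  | empty => exact isAlgSet_empty
  | insert _ _ ih => rw [Set.insert_eq]; exact (isAlgSet_singleton _).union ih

/-- vanishing ideal -/
def vI (Y : Set (Pt r)) : Ideal (MvPolynomial (Fin (r+1)) ℂ) where
  carrier := {p | ∀ x ∈ Y, VanishesAt p x}
  add_mem' := fun ha hb x hx v hv h => by rw [map_add, ha x hx v hv h, hb x hx v hv h, add_zero]
  zero_mem' := fun x hx v hv h => map_zero _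
  smul_mem' := fun c p hp x hx v hv h => by rw [smul_eq_mul, map_mul, hp x hx v hv h, mul_zero]

lemma vI_strict {Y Z : Set (Pt r)} (hY : IsAlgSet Y) (h : Y ⊂ Z) : vI Z < vI Y := by
  refine lt_of_le_of_ne (fun p hp x hx => hp x (h.1 hx)) ?_
  intro he
  apply h.2
  obtain ⟨S, hS, rfl⟩ := hY
  intro x hx p hp
  have : p ∈ vI Z := by rw [he]; intro y hy; exact hy p hp
  exact this x hx

lemma exists_min_algSet (P : Set (Pt r) → Prop) {Y : Set (Pt r)} (hY : IsAlgSet Y) (hP : P Y) :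
    ∃ Z, IsAlgSet Z ∧ P Z ∧ Z ⊆ Y ∧ ∀ W, IsAlgSet W → P W → W ⊆ Z → W = Z := by
  have wf : WellFounded ((· > ·) : Ideal (MvPolynomial (Fin (r+1)) ℂ) → _ → Prop) := wellFounded_gt
  obtain ⟨I, ⟨Z, ⟨hZ1, hZ2, hZ3⟩, rfl⟩, hmin⟩ := 
    wf.has_min (vI '' {Z | IsAlgSet Z ∧ P Z ∧ Z ⊆ Y}) ⟨_, ⟨Y, ⟨hY, hP, subset_rfl⟩, rfl⟩⟩
  refine ⟨Z, hZ1, hZ2, hZ3, ?_⟩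
  intro W hW hPW hWZ
  by_contra hne
  exact hmin _ ⟨W, ⟨hW, hPW, hWZ.trans hZ3⟩, rfl⟩ (vI_strict hW (hWZ.ssubset_of_ne hne))

lemma infinite_subset {X Y : Set (Pt r)} (hX : IsIrrVar X) (hd : ¬ DimGE X 2) (hY : IsAlgSet Y)
    (hinf : (X ∩ Y).Infinite) : X ⊆ Y := by
  by_contra hXY
  obtain ⟨Z, hZ, hZi, hZs, hmin⟩ := exists_min_algSet (fun W => W.Infinite) (hX.2.1.inter hY) hinf
  have hZirr : IsIrrVar Z := by
    refine ⟨hZi.nonempty, hZ, ?_⟩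
    intro A B hA hB hAB
    have : Z = (Z ∩ A) ∪ (Z ∩ B) := by rw [← Set.inter_union_distrib_left]; exact (Set.inter_eq_left.2 hAB).symm
    rw [this] at hZi
    rcases Set.infinite_union.1 hZi with h | h
    · left; exact Set.inter_eq_left.1 (hmin _ (hZ.inter hA) h Set.inter_subset_left)
    · right; exact Set.inter_eq_left.1 (hmin _ (hZ.inter hB) h Set.inter_subset_left)
  obtain ⟨z, hz⟩ := hZi.nonempty
  have hzirr : IsIrrVar {z} := by
    refine ⟨⟨z, rfl⟩, isAlgSet_singleton z, ?_⟩
    intro A B _ _ h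
    simpa using h
  have hzZ : ({z} : Set (Pt r)) ⊂ Z := by
    refine (Set.singleton_subset_iff.2 hz).ssubset_of_ne ?_
    rintro rfl
    exact hZi (Set.finite_singleton z)
  have hZX : Z ⊂ X := by
    refine (hZs.trans Set.inter_subset_left).ssubset_of_ne ?_
    rintro rfl
    exact hXY (hZs.trans Set.inter_subset_right)
  apply hd
  refine ⟨![{z}, Z, X], ?_, ?_⟩
  · intro i; fin_cases i
    · exact ⟨hzirr, (hzZ.trans hZX).1⟩
    · exact ⟨hZirr, hZX.1⟩
    · exact ⟨hX, subset_rfl⟩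
  · intro i j hij
    fin_cases i <;> fin_cases j <;> simp at hij ⊢
    · exact hzZ
    · exact hzZ.trans hZX
    · exact hZX

lemma irr_finite {X : Set (Pt r)} (hX : IsIrrVar X) (hf : X.Finite) : ∃ x, X = {x} := by
  obtain ⟨x, hx⟩ := hX.1
  rcases hX.2.2 {x} (X \ {x}) (isAlgSet_singleton x) (isAlgSet_finite (hf.subset Set.diff_subset)) (by
    intro y hy; by_cases h : y = x <;> simp [h, hy]) with h | h
  · exact ⟨x, h.antisymm (Set.singleton_subset_iff.2 hx)⟩
  · exact absurd rfl (h hx).2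

end AlgSets


abbrev V4 := Fin 4 → ℂ

/-- functions given by polynomials over a subfield -/
def PF (K : Subfield ℂ) (f : V4 → ℂ) : Prop := ∃ P : MvPolynomial (Fin 4) K, ∀ v, f v = aeval v P

lemma PF.const {K : Subfield ℂ} {c : ℂ} (h : c ∈ K) : PF K (fun _ => c) :=
  ⟨C ⟨c, h⟩, fun v => by rw [aeval_C]; rfl⟩

lemma PF.coord (K : Subfield ℂ) (i : Fin 4) : PF K (fun v => v i) :=
  ⟨X i, fun v => by rw [aeval_X]⟩

lemma PF.add {K : Subfield ℂ} {f g : V4 → ℂ} (hf : PF K f) (hg : PF K g) : PF K (fun v => f v + g v) := by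
  obtain ⟨P, hP⟩ := hf
  obtain ⟨R, hR⟩ := hg
  exact ⟨P + R, fun v => by rw [map_add, ← hP, ← hR]⟩

lemma PF.mul {K : Subfield ℂ} {f g : V4 → ℂ} (hf : PF K f) (hg : PF K g) : PF K (fun v => f v * g v) := by
  obtain ⟨P, hP⟩ := hf
  obtain ⟨R, hR⟩ := hg
  exact ⟨P * R, fun v => by rw [map_mul, ← hP, ← hR]⟩

lemma PF.sub {K : Subfield ℂ} {f g : V4 → ℂ} (hf : PF K f) (hg : PF K g) : PF K (fun v => f v - g v) := by
  obtain ⟨P, hP⟩ := hf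
  obtain ⟨R, hR⟩ := hg
  exact ⟨P - R, fun v => by rw [map_sub, ← hP, ← hR]⟩

lemma PF.sum {K : Subfield ℂ} {ι : Type} (s : Finset ι) {f : ι → V4 → ℂ} (hf : ∀ i, PF K (f i)) :
    PF K (fun v => ∑ i ∈ s, f i v) := by
  choose P hP using hf
  exact ⟨∑ i ∈ s, P i, fun v => by rw [map_sum]; exact Finset.sum_congr rfl fun i _ => hP i v⟩

lemma PF.prod {K : Subfield ℂ} {ι : Type} (s : Finset ι) {f : ι → V4 → ℂ} (hf : ∀ i, PF K (f i)) :
    PF K (fun v => ∏ i ∈ s, f i v) := by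
  choose P hP using hf
  exact ⟨∏ i ∈ s, P i, fun v => by rw [map_prod]; exact Finset.prod_congr rfl fun i _ => hP i v⟩

lemma PF.pow {K : Subfield ℂ} {f : V4 → ℂ} (hf : PF K f) (n : ℕ) : PF K (fun v => f v ^ n) := by
  obtain ⟨P, hP⟩ := hf
  exact ⟨P ^ n, fun v => by rw [map_pow, ← hP]⟩

lemma PF.mono {K L : Subfield ℂ} (h : K ≤ L) {f : V4 → ℂ} (hf : PF K f) : PF L f := by
  obtain ⟨P, hP⟩ := hf
  refine ⟨map (Subfield.inclusion h) P, fun v => ?_⟩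
  rw [hP, aeval_def, aeval_def, eval₂_map]
  rfl

/-- determinant of four vectors -/
def dt (a b c d : V4) : ℂ := Matrix.det (Matrix.of ![a, b, c, d])

lemma PF.det {K : Subfield ℂ} {f : Fin 4 → Fin 4 → V4 → ℂ} (hf : ∀ i j, PF K (f i j)) :
    PF K (fun v => Matrix.det (Matrix.of fun i j => f i j v)) := by
  simp only [Matrix.det_apply']
  refine PF.sum _ fun σ => PF.mul (PF.const (intCast_mem K _)) (PF.prod _ fun i => hf _ _)

lemma PF.dt {K : Subfield ℂ} {a b c d : V4 → V4} (ha : ∀ j, PF K (fun v => a v j)) (hb : ∀ j, PF K (fun v => b v j))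
    (hc : ∀ j, PF K (fun v => c v j)) (hd : ∀ j, PF K (fun v => d v j)) :
    PF K (fun v => dt (a v) (b v) (c v) (d v)) := by
  have := PF.det (K := K) (f := fun i j v => (![a v, b v, c v, d v] : Fin 4 → V4) i j) (by
    intro i j; fin_cases i
    · exact ha j
    · exact hb j
    · exact hc j
    · exact hd j)
  exact this

/-- rational points -/
def Rat (S : Set ℂ) (v : V4) : Prop := ∀ i, v i ∈ acl S

/-- adjoining a point -/
def adj (S : Set ℂ) (x : V4) : Set ℂ := S ∪ Set.range x

lemma sub_adj (S : Set ℂ) (x : V4) : S ⊆ adj S x := Set.subset_union_left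
lemma rat_adj (S : Set ℂ) (x : V4) : Rat (adj S x) x := fun i => subset_acl _ (Or.inr ⟨i, rfl⟩)
lemma Rat.mono {S T : Set ℂ} (h : S ⊆ T) {x : V4} (hx : Rat S x) : Rat T x := fun i => acl_mono h (hx i)
lemma adj_mono {S T : Set ℂ} (h : S ⊆ T) (x : V4) : adj S x ⊆ adj T x := Set.union_subset_union_left _ h
lemma adj_comm (S : Set ℂ) (x y : V4) : adj (adj S x) y = adj (adj S y) x := by
  simp only [adj, Set.union_assoc]; rw [Set.union_comm (Set.range x)]
lemma adj_le {S T : Set ℂ} {x : V4} (hS : S ⊆ acl T) (hx : Rat T x) : acl (adj S x) ≤ acl T := by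
  apply acl_le
  rintro z (hz | ⟨i, rfl⟩)
  · exact hS hz
  · exact hx i
lemma adj_countable {S : Set ℂ} (h : S.Countable) (x : V4) : (adj S x).Countable :=
  h.union (Set.countable_range x)

/-- The affine incarnation of our curve -/
structure Cur (Q : Set V4) (S0 : Set ℂ) : Prop where
  h0 : ∀ v ∈ Q, v 0 = 1
  ctb : S0.Countable
  eqs : ∃ E : Set (V4 → ℂ), (∀ g ∈ E, PF (acl S0) g) ∧ ∀ v, v ∈ Q ↔ ∀ g ∈ E, g v = 0
  zinf : ∀ P : MvPolynomial (Fin 4) ℂ, {v | v ∈ Q ∧ eval v P = 0}.Infinite → ∀ v ∈ Q, eval v P = 0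
  inf : Q.Infinite
  nd : ∀ a : V4, (∀ v ∈ Q, ∑ i, a i * v i = 0) → a = 0
  sec : ∃ h : MvPolynomial (Fin 4) (acl S0), (∃ x ∈ Q, ∃ y ∈ Q, ∃ t : ℂ, aeval (x + t • y) h ≠ 0) ∧
    ∀ x1 ∈ Q, ∀ x2 ∈ Q, ∀ x3 ∈ Q, ∀ x4 ∈ Q, x1 ≠ x2 → x3 ≠ x4 → ∀ t a b : ℂ,
      aeval (x1 + t • x2) h ≠ 0 → x1 + t • x2 = a • x3 + b • x4 → ∃ c d : ℂ, x3 = c • x1 + d • x2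

lemma PF.toC {K : Subfield ℂ} {f : V4 → ℂ} (hf : PF K f) : ∃ P : MvPolynomial (Fin 4) ℂ, ∀ v, f v = eval v P := by
  obtain ⟨P, hP⟩ := hf
  refine ⟨map (algebraMap K ℂ) P, fun v => ?_⟩
  rw [hP, aeval_def, eval_map]

section

lemma f2a {Q : Set V4} {S0 : Set ℂ} (hQ : Cur Q S0) {K : Subfield ℂ} {f : V4 → ℂ} (hf : PF K f) (h : {v | v ∈ Q ∧ f v = 0}.Infinite) : ∀ v ∈ Q, f v = 0 := by
  obtain ⟨P, hP⟩ := hf.toC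
  simp only [hP] at h ⊢
  exact hQ.zinf P h

lemma f3pre {Q : Set V4} {S0 : Set ℂ} (hQ : Cur Q S0) {S : Set ℂ} (hS : S0 ⊆ S) {G : V4 → ℂ} (hG : PF (acl S) G) {x : V4} (hx : x ∈ Q) (hxS : ¬ Rat S x)
    (hGx : G x = 0) : {v | v ∈ Q ∧ Rat S v ∧ G v = 0}.Infinite := by
  intro hfin
  obtain ⟨j, hj⟩ := not_forall.1 hxS
  set I : Ideal (MvPolynomial (Fin 4) (acl S)) := RingHom.ker (aeval x : MvPolynomial (Fin 4) (acl S) →ₐ[acl S] ℂ).toRingHom with hI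
  have hIp : I.IsPrime := RingHom.ker_isPrime _
  have hz : ∀ w ∈ zeroLocus (acl S) I, (fun i => (w i : ℂ)) ∈ {v | v ∈ Q ∧ Rat S v ∧ G v = 0} := by
    intro w hw
    have key : ∀ g, PF (acl S) g → g x = 0 → g (fun i => (w i : ℂ)) = 0 := by
      rintro g ⟨P, hP⟩ hg
      have h1 : P ∈ I := by
        rw [hI, RingHom.mem_ker]; exact (hP x).symm.trans hg
      have h2 := hw P h1
      rw [hP]
      have := aeval_algebraMap_apply ℂ w P
      rw [h2, map_zero] at this
      exact this
    refine ⟨?_, fun i => (w i).2, key G hG hGx⟩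
    obtain ⟨E, hE1, hE2⟩ := hQ.eqs
    rw [hE2]
    intro g hg
    exact key g ((hE1 g hg).mono (acl_mono hS)) ((hE2 x).1 hx g hg)
  let T : Finset (acl S) := (hfin.toFinset.image (fun v => v j)).preimage (fun c : acl S => (c : ℂ)) (Subtype.val_injective.injOn)
  let q : MvPolynomial (Fin 4) (acl S) := ∏ c ∈ T, (X j - C c)
  have hq : q ∈ vanishingIdeal (acl S) (zeroLocus (acl S) I) := by
    intro w hw
    have h1 := hz w hw
    have h2 : w j ∈ T := by
      simp only [T, Finset.mem_preimage, Finset.mem_image]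
      exact ⟨_, hfin.mem_toFinset.2 h1, rfl⟩
    simp only [q, map_prod]
    refine Finset.prod_eq_zero h2 ?_
    simp
  rw [IsPrime.vanishingIdeal_zeroLocus, hI, RingHom.mem_ker] at hq
  have hq' : aeval x q = 0 := hq
  simp only [q, map_prod, Finset.prod_eq_zero_iff] at hq'
  obtain ⟨c, _, hc⟩ := hq'
  apply hj
  rw [map_sub, aeval_X, aeval_C, sub_eq_zero] at hc
  rw [hc]
  exact c.2

lemma f3 {Q : Set V4} {S0 : Set ℂ} (hQ : Cur Q S0) {S : Set ℂ} (hS : S0 ⊆ S) {G : V4 → ℂ} (hG : PF (acl S) G) {x : V4} (hx : x ∈ Q) (hxS : ¬ Rat S x)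
    (hGx : G x = 0) : ∀ v ∈ Q, G v = 0 :=
  f2a hQ hG ((f3pre hQ hS hG hx hxS hGx).mono fun v hv => ⟨hv.1, hv.2.2⟩)

lemma coord_nonconst {Q : Set V4} {S0 : Set ℂ} (hQ : Cur Q S0) : ∃ j, ∀ c : ℂ, ∃ v ∈ Q, v j ≠ c := by
  by_contra hcon
  push Not at hcon
  choose c hc using hcon
  apply hQ.inf
  refine (Set.finite_singleton c).subset ?_
  intro v hv
  ext j; exact hc j v hv

lemma exists_gen {Q : Set V4} {S0 : Set ℂ} (hQ : Cur Q S0) {S : Set ℂ} (hS : S.Countable) : ∃ x ∈ Q, ¬ Rat S x := by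
  by_contra hcon
  push Not at hcon
  obtain ⟨j, hj⟩ := coord_nonconst hQ
  set I : Ideal (MvPolynomial (Fin 4) ℂ) := vanishingIdeal ℂ Q with hI
  have hIp : I.IsPrime := by
    refine ⟨?_, ?_⟩
    · intro h
      obtain ⟨v, hv⟩ := hQ.inf.nonempty
      have : (1 : MvPolynomial (Fin 4) ℂ) ∈ I := by rw [h]; trivial
      simpa using this v hv
    · intro p q hpq
      have h1 : Q ⊆ {v | v ∈ Q ∧ eval v p = 0} ∪ {v | v ∈ Q ∧ eval v q = 0} := by
        intro v hv
        have := hpq v hv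
        rw [map_mul, mul_eq_zero] at this
        rcases this with h | h
        · left; exact ⟨hv, by rwa [aeval_eq_eval] at h⟩
        · right; exact ⟨hv, by rwa [aeval_eq_eval] at h⟩
      rcases Set.infinite_union.1 (hQ.inf.mono h1) with h | h
      · left; intro v hv; rw [aeval_eq_eval]; exact hQ.zinf p h v hv
      · right; intro v hv; rw [aeval_eq_eval]; exact hQ.zinf q h v hv
  let A := MvPolynomial (Fin 4) ℂ ⧸ I
  let F := FractionRing A
  let φ : MvPolynomial (Fin 4) ℂ →ₐ[ℂ] F := (IsScalarTower.toAlgHom ℂ A F).comp (Ideal.Quotient.mkₐ ℂ I)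
  have hφ : ∀ p, φ p = 0 ↔ p ∈ I := by
    intro p
    change algebraMap A F (Ideal.Quotient.mk I p) = 0 ↔ _
    rw [map_eq_zero_iff _ (IsFractionRing.injective A F), Ideal.Quotient.eq_zero_iff_mem]
  have htr : Transcendental ℂ (φ (X j)) := by
    intro halg
    have : φ (X j) ∈ (algebraMap ℂ F).range := by
      exact minpoly.mem_range_of_degree_eq_one ℂ _
        (IsAlgClosed.degree_eq_one_of_irreducible ℂ (minpoly.irreducible halg.isIntegral))
    obtain ⟨c, hc⟩ := this
    have h2 : X j - C c ∈ I := by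
      rw [← hφ, map_sub, ← hc]
      have : φ (C c) = algebraMap ℂ F c := φ.commutes c
      rw [this, sub_self]
    obtain ⟨v, hv, hv'⟩ := hj c
    have := h2 v hv
    apply hv'
    simpa [sub_eq_zero] using this
  have hli := htr.linearIndependent_sub_inv
  have hinv : ∀ c : ((acl S : Set ℂ)ᶜ : Set ℂ), ∃ p, φ p = (φ (X j) - algebraMap ℂ F c)⁻¹ := by
    rintro ⟨c, hc⟩
    have h1 : I ⊔ Ideal.span {X j - C c} = ⊤ := by
      rw [← Ideal.radical_eq_top, ← vanishingIdeal_zeroLocus_eq_radical (K := ℂ)]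
      convert vanishingIdeal_empty
      rw [Set.eq_empty_iff_forall_notMem]
      intro w hw
      have hwQ : w ∈ Q := by
        obtain ⟨E, hE1, hE2⟩ := hQ.eqs
        rw [hE2]
        intro g hg
        obtain ⟨P, hP⟩ := (hE1 g hg).toC
        rw [hP, ← aeval_eq_eval]
        refine hw P (Ideal.mem_sup_left ?_)
        intro v hv
        rw [aeval_eq_eval]
        have := (hE2 v).1 hv g hg
        rwa [hP] at this
      have h2 := hw _ (Ideal.mem_sup_right (Ideal.subset_span rfl))
      simp [sub_eq_zero] at h2
      apply hc
      rw [← h2]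
      exact hcon w hwQ j
    have h2 : (1 : MvPolynomial (Fin 4) ℂ) ∈ I ⊔ Ideal.span {X j - C c} := by rw [h1]; trivial
    obtain ⟨a, ha, b, hb, hab⟩ := Submodule.mem_sup.1 h2
    obtain ⟨p, rfl⟩ := Ideal.mem_span_singleton'.1 hb
    refine ⟨p, ?_⟩
    have h3 := congrArg φ hab
    have h4 : φ (C c) = algebraMap ℂ F c := φ.commutes c
    rw [map_add, (hφ a).2 ha, zero_add, map_mul, map_sub, h4, map_one] at h3
    exact eq_inv_of_mul_eq_one_left h3
  choose p hp using hinv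
  have hli2 : LinearIndependent ℂ p := by
    apply LinearIndependent.of_comp φ.toLinearMap
    have := hli.comp (fun c : ((acl S : Set ℂ)ᶜ : Set ℂ) => (c : ℂ)) Subtype.val_injective
    have h : (φ.toLinearMap ∘ p) = _ := funext fun c => hp c
    rw [h]
    exact this
  have h1 := hli2.cardinal_le_rank
  have h2 : Module.rank ℂ (MvPolynomial (Fin 4) ℂ) ≤ Cardinal.aleph0 := by
    rw [← (basisMonomials (Fin 4) ℂ).mk_eq_rank'']
    exact Cardinal.mk_le_aleph0
  have h3 : ((acl S : Set ℂ)ᶜ : Set ℂ).Countable := by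
    rw [← Cardinal.le_aleph0_iff_set_countable]
    exact h1.trans h2
  have h4 := h3.union (acl_countable hS)
  rw [Set.compl_union_self] at h4
  exact not_countable_complex h4

end


lemma PF.comp {K : Subfield ℂ} {g : V4 → ℂ} (hg : PF K g) {w : V4 → V4} (hw : ∀ i, PF K (fun v => w v i)) :
    PF K (fun v => g (w v)) := by
  obtain ⟨P, hP⟩ := hg
  choose p hp using hw
  refine ⟨aeval p P, fun v => ?_⟩
  beta_reduce
  rw [hP, comp_aeval_apply]
  congr 2
  ext i; exact hp i v

/-- one-variable polynomial functions -/
def PF1 (K : Subfield ℂ) (f : ℂ → ℂ) : Prop := ∃ P : Polynomial K, ∀ t, f t = Polynomial.aeval t P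

lemma PF1.const {K : Subfield ℂ} {c : ℂ} (h : c ∈ K) : PF1 K (fun _ => c) :=
  ⟨Polynomial.C ⟨c, h⟩, fun v => by rw [Polynomial.aeval_C]; rfl⟩
lemma PF1.id (K : Subfield ℂ) : PF1 K (fun t => t) := ⟨Polynomial.X, fun v => by rw [Polynomial.aeval_X]⟩
lemma PF1.add {K : Subfield ℂ} {f g : ℂ → ℂ} (hf : PF1 K f) (hg : PF1 K g) : PF1 K (fun v => f v + g v) := by
  obtain ⟨P, hP⟩ := hf
  obtain ⟨R, hR⟩ := hg
  exact ⟨P + R, fun v => by rw [map_add, ← hP, ← hR]⟩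
lemma PF1.mul {K : Subfield ℂ} {f g : ℂ → ℂ} (hf : PF1 K f) (hg : PF1 K g) : PF1 K (fun v => f v * g v) := by
  obtain ⟨P, hP⟩ := hf
  obtain ⟨R, hR⟩ := hg
  exact ⟨P * R, fun v => by rw [map_mul, ← hP, ← hR]⟩
lemma PF1.comp {K : Subfield ℂ} {g : V4 → ℂ} (hg : PF K g) {w : ℂ → V4} (hw : ∀ i, PF1 K (fun v => w v i)) :
    PF1 K (fun v => g (w v)) := by
  obtain ⟨P, hP⟩ := hg
  choose p hp using hw
  refine ⟨aeval p P, fun v => ?_⟩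
  beta_reduce
  rw [hP, comp_aeval_apply]
  congr 2
  ext i; exact hp i v
lemma PF1.eq_zero {S : Set ℂ} {f : ℂ → ℂ} (hf : PF1 (acl S) f) {t : ℂ} (ht : t ∉ acl S) (h : f t = 0) : ∀ u, f u = 0 := by
  obtain ⟨P, hP⟩ := hf
  have h1 : P = 0 := by
    by_contra hne
    rw [hP] at h
    exact transcendental_acl ht ⟨P, hne, h⟩
  intro u
  rw [hP, h1, map_zero]
lemma PF1.eq_zero_inf {K : Subfield ℂ} {f : ℂ → ℂ} (hf : PF1 K f) (h : {t | f t = 0}.Infinite) : ∀ u, f u = 0 := by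
  obtain ⟨P, hP⟩ := hf
  have h1 : P.map (algebraMap K ℂ) = 0 := by
    refine Polynomial.eq_zero_of_infinite_isRoot _ (h.mono ?_)
    intro t ht
    have ht' : f t = 0 := ht
    rw [hP] at ht'
    rw [Set.mem_setOf_eq, Polynomial.IsRoot.def, Polynomial.eval_map_algebraMap, ht']
  intro u
  rw [hP, ← Polynomial.eval_map_algebraMap, h1, Polynomial.eval_zero]

lemma aeval_incl {S T : Set ℂ} (h : S ⊆ T) (p : MvPolynomial (Fin 4) (acl S)) :
    ∃ q : MvPolynomial (Fin 4) (acl T), ∀ v : V4, aeval v q = aeval v p := by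
  obtain ⟨q, hq⟩ := PF.mono (acl_mono h) (f := fun v => aeval v p) ⟨p, fun v => rfl⟩
  exact ⟨q, fun v => (hq v).symm⟩

lemma Cur.mono {Q : Set V4} {S0 S : Set ℂ} (hQ : Cur Q S0) (h : S0 ⊆ S) (hc : S.Countable) : Cur Q S where
  h0 := hQ.h0
  ctb := hc
  eqs := by
    obtain ⟨E, h1, h2⟩ := hQ.eqs
    exact ⟨E, fun g hg => (h1 g hg).mono (acl_mono h), h2⟩
  zinf := hQ.zinf
  inf := hQ.inf
  nd := hQ.nd
  sec := by
    obtain ⟨p, ⟨x, hx, y, hy, t, h1⟩, h2⟩ := hQ.sec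
    obtain ⟨q, key⟩ := aeval_incl h p
    refine ⟨q, ⟨x, hx, y, hy, t, ?_⟩, ?_⟩
    · rw [key]; exact h1
    · intro x1 h1 x2 h3 x3 h4 x4 h5 h6 h7 t a b h8
      rw [key] at h8
      exact h2 x1 h1 x2 h3 x3 h4 x4 h5 h6 h7 t a b h8

lemma Cur.adj {Q : Set V4} {S0 : Set ℂ} (hQ : Cur Q S0) (x : V4) : Cur Q (adj S0 x) :=
  hQ.mono (sub_adj _ _) (adj_countable hQ.ctb x)

lemma dt_ne_zero_iff {a b c d : V4} : dt a b c d ≠ 0 ↔ LinearIndependent ℂ ![a, b, c, d] := by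
  have := Matrix.linearIndependent_rows_iff_isUnit (A := Matrix.of ![a, b, c, d])
  rw [Matrix.isUnit_iff_isUnit_det, isUnit_iff_ne_zero] at this
  exact this.symm

section

lemma ne_zero_of_mem {Q : Set V4} {S : Set ℂ} (hQ : Cur Q S) {x : V4} (hx : x ∈ Q) : x ≠ 0 := by
  rintro rfl
  simpa using hQ.h0 _ hx

lemma linform_ne {Q : Set V4} {S : Set ℂ} (hQ : Cur Q S) {a : V4} (ha : Rat S a) (ha0 : a ≠ 0) {y : V4} (hy : y ∈ Q) (hyS : ¬ Rat S y) : ∑ i, a i * y i ≠ 0 := by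
  intro h
  apply ha0
  apply hQ.nd
  exact f3 hQ subset_rfl (PF.sum _ fun i => (PF.const (ha i)).mul (PF.coord _ i)) hy hyS h

lemma notin_span {Q : Set V4} {S : Set ℂ} (hQ : Cur Q S) {w : Fin 3 → V4} (hw : ∀ i, Rat S (w i)) {y : V4} (hy : y ∈ Q) (hyS : ¬ Rat S y) :
    y ∉ Submodule.span ℂ (Set.range w) := by
  intro hmem
  let M : Matrix (Fin 3) (Fin 4) (acl S) := Matrix.of fun i j => ⟨w i j, hw i j⟩
  have hker : LinearMap.ker M.mulVecLin ≠ ⊥ := LinearMap.ker_ne_bot_of_finrank_lt (by simp)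
  obtain ⟨a, ha, ha0⟩ := Submodule.exists_mem_ne_zero_of_ne_bot hker
  refine linform_ne hQ (a := fun i => (a i : ℂ)) (fun i => (a i).2) ?_ hy hyS ?_
  · intro h; apply ha0; ext i; exact congrFun h i
  · let φ : V4 →ₗ[ℂ] ℂ := ∑ i, (a i : ℂ) • LinearMap.proj i
    have hφ : ∀ v, φ v = ∑ i, (a i : ℂ) * v i := by intro v; simp [φ]
    rw [← hφ]
    have : Submodule.span ℂ (Set.range w) ≤ LinearMap.ker φ := by
      rw [Submodule.span_le]
      rintro _ ⟨k, rfl⟩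
      have := congrFun ((LinearMap.mem_ker).1 ha) k
      have h2 := congrArg (fun z : acl S => (z : ℂ)) this
      simp only [Matrix.mulVecLin_apply, Matrix.mulVec, dotProduct] at h2
      rw [SetLike.mem_coe, LinearMap.mem_ker, hφ]
      rw [← show _ = (0 : ℂ) from h2]
      push_cast
      exact Finset.sum_congr rfl fun i _ => mul_comm _ _
    exact this hmem

lemma notin_span3 {Q : Set V4} {S : Set ℂ} (hQ : Cur Q S) {a b c : V4} (ha : Rat S a) (hb : Rat S b) (hc : Rat S c) {y : V4} (hy : y ∈ Q) (hyS : ¬ Rat S y)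
    (α β γ : ℂ) : y ≠ α • a + β • b + γ • c := by
  intro h
  apply notin_span hQ (w := ![a, b, c]) (by intro i; fin_cases i; exacts [ha, hb, hc]) hy hyS
  rw [h]
  refine Submodule.add_mem _ (Submodule.add_mem _ ?_ ?_) ?_
  · exact Submodule.smul_mem _ _ (Submodule.subset_span ⟨0, rfl⟩)
  · exact Submodule.smul_mem _ _ (Submodule.subset_span ⟨1, rfl⟩)
  · exact Submodule.smul_mem _ _ (Submodule.subset_span ⟨2, rfl⟩)

lemma notin_span2 {Q : Set V4} {S : Set ℂ} (hQ : Cur Q S) {a b : V4} (ha : Rat S a) (hb : Rat S b) {y : V4} (hy : y ∈ Q) (hyS : ¬ Rat S y)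
    (α β : ℂ) : y ≠ α • a + β • b := by
  intro h
  exact notin_span3 hQ ha hb hb hy hyS α β 0 (by rw [h]; simp)

lemma dt_ne {Q : Set V4} {S : Set ℂ} (hQ : Cur Q S) {a b c : V4} (ha : Rat S a) (hb : Rat S b) (hc : Rat S c) (hli : LinearIndependent ℂ ![a, b, c])
    {y : V4} (hy : y ∈ Q) (hyS : ¬ Rat S y) : dt a b c y ≠ 0 := by
  rw [dt_ne_zero_iff]
  have h := notin_span hQ (w := ![a, b, c]) (by intro i; fin_cases i; exacts [ha, hb, hc]) hy hyS
  have := linearIndependent_finSnoc.2 ⟨hli, h⟩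
  have e : (Fin.snoc ![a, b, c] y : Fin 4 → V4) = ![a, b, c, y] := by
    funext i; fin_cases i <;> rfl
  rwa [← e]

lemma one_coord {Q : Set V4} {S : Set ℂ} (hQ : Cur Q S) {v : V4} (hv : v ∈ Q) {i : Fin 4} (hi : v i ∉ acl S) : Rat (insert (v i) S) v := by
  by_contra hr
  have hQ' := hQ.mono (Set.subset_insert (v i) S) (hQ.ctb.insert _)
  have hi0 : i ≠ 0 := by
    rintro rfl
    rw [hQ.h0 v hv] at hi
    exact hi (one_mem _)
  have h1 : v i ∈ acl (insert (v i) S) := subset_acl _ (Set.mem_insert _ _)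
  have := linform_ne hQ' (a := Pi.single i 1 - Pi.single 0 (v i)) ?_ ?_ hv hr
  · apply this
    simp [sub_mul, Finset.sum_sub_distrib, Pi.single_apply, hQ.h0 v hv]
  · intro k
    simp only [Pi.sub_apply, Pi.single_apply]
    apply sub_mem <;> split_ifs
    exacts [one_mem _, zero_mem _, h1, zero_mem _]
  · intro h
    have := congrFun h i
    simp [hi0] at this

lemma exch {Q : Set V4} {S : Set ℂ} (hQ : Cur Q S) {x y : V4} (hx : x ∈ Q) (hy : y ∈ Q) (h : Rat (adj S y) x) (hxS : ¬ Rat S x) : Rat (adj S x) y := by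
  by_cases hyS : Rat S y
  · exfalso; apply hxS
    intro i
    exact adj_le (subset_acl S) hyS (h i)
  obtain ⟨i, hi⟩ := not_forall.1 hyS
  obtain ⟨j, hj⟩ := not_forall.1 hxS
  have h1 := one_coord hQ hy hi
  have h2 : x j ∈ acl (insert (y i) S) := adj_le ((Set.subset_insert _ _).trans (subset_acl _)) h1 (h j)
  have h3 := acl_exchange h2 hj
  intro k
  refine acl_le ?_ (h1 k)
  have h4 : acl (insert (x j) S) ≤ acl (adj S x) := by
    apply acl_mono
    rintro z (rfl | hz)
    · exact Or.inr ⟨j, rfl⟩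
    · exact Or.inl hz
  rintro z (rfl | hz)
  · exact h4 h3
  · exact subset_acl _ (Or.inl hz)

/-- symmetric form of independence -/
lemma indep_symm {Q : Set V4} {S : Set ℂ} (hQ : Cur Q S) {x y : V4} (hx : x ∈ Q) (hy : y ∈ Q) (h1 : ¬ Rat S x) (h2 : ¬ Rat (adj S x) y) :
    ¬ Rat S y ∧ ¬ Rat (adj S y) x :=
  ⟨fun h => h2 (h.mono (sub_adj _ _)), fun h => h2 (exch hQ hx hy h h1)⟩

lemma rat_inf {Q : Set V4} {S : Set ℂ} (hQ : Cur Q S) : {v | v ∈ Q ∧ Rat S v}.Infinite := by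
  obtain ⟨x, hx, hxS⟩ := exists_gen hQ hQ.ctb
  exact (f3pre hQ subset_rfl (G := fun _ => 0) (PF.const (zero_mem _)) hx hxS rfl).mono fun v hv => ⟨hv.1, hv.2.1⟩

lemma p2 {Q : Set V4} {S : Set ℂ} (hQ : Cur Q S) {G : V4 → V4 → ℂ} (hG1 : ∀ T, S ⊆ T → ∀ x, Rat T x → PF (acl T) (fun y => G x y))
    (hG2 : ∀ T, S ⊆ T → ∀ y, Rat T y → PF (acl T) (fun x => G x y)) {x y : V4} (hx : x ∈ Q) (hy : y ∈ Q)
    (h1 : ¬ Rat S x) (h2 : ¬ Rat (adj S x) y) (h : G x y = 0) : ∀ x ∈ Q, ∀ y ∈ Q, G x y = 0 := by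
  have a1 := f3 (hQ.adj x) subset_rfl (hG1 _ (sub_adj _ _) x (rat_adj _ _)) hy h2 h
  have a2 : ∀ y ∈ Q, Rat S y → ∀ x ∈ Q, G x y = 0 := fun y hy hyr =>
    f3 hQ subset_rfl (hG2 _ subset_rfl y hyr) hx h1 (a1 y hy)
  intro x' hx'
  refine f2a hQ (hG1 _ (sub_adj S x') x' (rat_adj _ _)) ((rat_inf hQ).mono ?_)
  intro v hv
  exact ⟨hv.1, a2 v hv.1 hv.2 x' hx'⟩

lemma sec_gen {Q : Set V4} {S : Set ℂ} (hQ : Cur Q S) : ∃ h : MvPolynomial (Fin 4) (acl S), 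
    (∀ x ∈ Q, ∀ y ∈ Q, ¬ Rat S x → ¬ Rat (adj S x) y → ∀ t, t ∉ acl (adj (adj S x) y) → aeval (x + t • y) h ≠ 0) ∧
    ∀ x1 ∈ Q, ∀ x2 ∈ Q, ∀ x3 ∈ Q, ∀ x4 ∈ Q, x1 ≠ x2 → x3 ≠ x4 → ∀ t a b : ℂ,
      aeval (x1 + t • x2) h ≠ 0 → x1 + t • x2 = a • x3 + b • x4 → ∃ c d : ℂ, x3 = c • x1 + d • x2 := by
  obtain ⟨h, ⟨x', hx', y', hy', t', ht'⟩, h2⟩ := hQ.sec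
  refine ⟨h, ?_, h2⟩
  intro x hx y hy hxS hyS t ht h0
  apply ht'
  have hPF : PF (acl S) (fun v => aeval v h) := ⟨h, fun v => rfl⟩
  have b1 : ∀ T, S ⊆ T → ∀ x y : V4, Rat T x → Rat T y → PF1 (acl T) (fun t => aeval (x + t • y) h) := by
    intro T hT x y hx hy
    refine PF1.comp (hPF.mono (acl_mono hT)) (w := fun t => x + t • y) fun i => ?_
    exact (PF1.const (hx i)).add ((PF1.id _).mul (PF1.const (hy i)))
  have c1 := (b1 (adj (adj S x) y) ((sub_adj _ _).trans (sub_adj _ _)) x y ((rat_adj _ _).mono (sub_adj _ _)) (rat_adj _ _)).eq_zero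
    ht h0
  have c2 : ∀ u ∈ acl S, ∀ x ∈ Q, ∀ y ∈ Q, aeval (x + u • y) h = 0 := by
    intro u hu
    refine p2 hQ (G := fun x y => aeval (x + u • y) h) ?_ ?_ hx hy hxS hyS (c1 u)
    · intro T hT x hx
      exact PF.comp (hPF.mono (acl_mono hT)) (w := fun y => x + u • y) fun i => 
        (PF.const (hx i)).add ((PF.const (acl_mono hT hu)).mul (PF.coord _ i))
    · intro T hT y hy
      exact PF.comp (hPF.mono (acl_mono hT)) (w := fun x => x + u • y) fun i => 
        (PF.coord _ i).add (PF.const (mul_mem (acl_mono hT hu) (hy i)))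
  refine PF1.eq_zero_inf (b1 (adj (adj S x') y') ((sub_adj _ _).trans (sub_adj _ _)) x' y' ((rat_adj _ _).mono (sub_adj _ _)) (rat_adj _ _)) ?_ t'
  have : (Set.range (fun n : ℕ => (n : ℂ))).Infinite := Set.infinite_range_of_injective Nat.cast_injective
  refine this.mono ?_
  rintro _ ⟨n, rfl⟩
  exact c2 n (natCast_mem _ n) x' hx' y' hy'

end


/-- derivations killing a field -/
def Kills (D : Derivation ℤ ℂ ℂ) (S : Set ℂ) : Prop := ∀ z ∈ acl S, D z = 0

lemma Kills.mono {D : Derivation ℤ ℂ ℂ} {S T : Set ℂ} (h : S ⊆ T) (hD : Kills D T) : Kills D S :=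
  fun z hz => hD z (acl_mono h hz)

lemma exists_kills {S : Set ℂ} {t : ℂ} (h : t ∉ acl S) : ∃ D : Derivation ℤ ℂ ℂ, Kills D S ∧ D t ≠ 0 := by
  obtain ⟨D, hD⟩ := exists_der h
  refine ⟨D.restrictScalars ℤ, ?_, hD⟩
  intro z hz
  exact D.map_algebraMap (⟨z, hz⟩ : acl S)

lemma kills_insert {D : Derivation ℤ ℂ ℂ} {S : Set ℂ} (hD : Kills D S) {c : ℂ} (hc : D c = 0) : Kills D (insert c S) := by
  intro z hz
  let D' : Derivation (acl S) ℂ ℂ :=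
    { toFun := D
      map_add' := fun a b => map_add D a b
      map_smul' := fun a b => by
        have : a • b = (a : ℂ) * b := rfl
        rw [this, D.leibniz, hD a a.2]
        simp; rfl
      map_one_eq_zero' := D.map_one_eq_zero
      leibniz' := fun a b => D.leibniz a b }
  refine der_acl D' ?_ hz
  rintro w (rfl | hw)
  · exact hc
  · exact hD w (subset_acl _ hw)

open Polynomial in
lemma der_aeval {S : Set ℂ} {D : Derivation ℤ ℂ ℂ} (hD : Kills D S) (p : Polynomial (acl S)) (a : ℂ) :
    D (aeval a p) = aeval a (derivative p) * D a := by
  induction p using Polynomial.induction_on' with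
  | add p q hp hq => simp only [map_add, hp, hq]; ring
  | monomial n c =>
    rw [Polynomial.aeval_monomial, derivative_monomial, Polynomial.aeval_monomial, D.leibniz, D.leibniz_pow]
    have : D (algebraMap (acl S) ℂ c) = 0 := hD c c.2
    rw [this]
    simp only [smul_eq_mul, nsmul_eq_mul, map_mul, map_natCast]
    ring

/-- evaluation of bivariate polynomials -/
def ev2 {S : Set ℂ} (a b : ℂ) (g : Polynomial (Polynomial (acl S))) : ℂ :=
  Polynomial.eval₂ (Polynomial.aeval a : Polynomial (acl S) →ₐ[acl S] ℂ).toRingHom b g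

open Polynomial in
lemma bider {S : Set ℂ} (g : Polynomial (Polynomial (acl S))) : ∃ A : Polynomial (Polynomial (acl S)),
    ∀ D : Derivation ℤ ℂ ℂ, Kills D S → ∀ a b, D (ev2 a b g) = ev2 a b (derivative g) * D b + ev2 a b A * D a := by
  induction g using Polynomial.induction_on' with
  | add p q hp hq =>
    obtain ⟨A, hA⟩ := hp
    obtain ⟨B, hB⟩ := hq
    refine ⟨A + B, fun D hD a b => ?_⟩
    have e := hA D hD a b
    have e' := hB D hD a b
    simp only [ev2] at e e' ⊢
    rw [derivative_add, Polynomial.eval₂_add, Polynomial.eval₂_add, Polynomial.eval₂_add, D.map_add, e, e']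
    ring
  | monomial n c =>
    refine ⟨monomial n (derivative c), fun D hD a b => ?_⟩
    simp only [ev2]
    rw [derivative_monomial, Polynomial.eval₂_monomial, Polynomial.eval₂_monomial, Polynomial.eval₂_monomial, D.leibniz, D.leibniz_pow]
    have : D (aeval a c) = _ := der_aeval hD c a
    simp only [AlgHom.toRingHom_eq_coe, RingHom.coe_coe, map_mul, map_natCast]
    rw [this]
    simp only [smul_eq_mul, nsmul_eq_mul]
    ring

lemma pf_ev2 {S : Set ℂ} (g : Polynomial (Polynomial (acl S))) (j l : Fin 4) : PF (acl S) (fun v => ev2 (v j) (v l) g) := by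
  refine ⟨Polynomial.eval₂ (Polynomial.aeval (X j) : Polynomial (acl S) →ₐ[acl S] MvPolynomial (Fin 4) (acl S)).toRingHom (X l) g, ?_⟩
  intro v
  have := Polynomial.hom_eval₂ g (Polynomial.aeval (X j) : Polynomial (acl S) →ₐ[acl S] MvPolynomial (Fin 4) (acl S)).toRingHom
    (aeval v : MvPolynomial (Fin 4) (acl S) →ₐ[acl S] ℂ).toRingHom (X l)
  simp only [AlgHom.toRingHom_eq_coe, RingHom.coe_coe, aeval_X] at this ⊢
  rw [this]
  simp only [ev2]
  congr 1
  ext p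
  · simp
  · simp

lemma exists_biv {S : Set ℂ} {a b : ℂ} (ha : a ∉ acl S) (hb : b ∈ acl (insert a S)) :
    ∃ g : Polynomial (Polynomial (acl S)), g ≠ 0 ∧ ev2 a b g = 0 := by
  have htr := transcendental_acl ha
  have hinj : Function.Injective (Polynomial.aeval a : Polynomial (acl S) →ₐ[acl S] ℂ) := transcendental_iff_injective.1 htr
  obtain ⟨p, hp, hpb⟩ := mem_acl.1 hb
  have hle : Algebra.adjoin ℚ (insert a S) ≤ ((Polynomial.aeval a : Polynomial (acl S) →ₐ[acl S] ℂ).range).restrictScalars ℚ := by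
    apply Algebra.adjoin_le
    rintro z (rfl | hz)
    · exact ⟨Polynomial.X, Polynomial.aeval_X _⟩
    · exact ⟨Polynomial.C ⟨z, subset_acl _ hz⟩, Polynomial.aeval_C _ _⟩
  let e := AlgEquiv.ofInjective _ hinj
  let f : Algebra.adjoin ℚ (insert a S) →+* Polynomial (acl S) :=
    (e.symm : _ →+* Polynomial (acl S)).comp
      (((Algebra.adjoin ℚ (insert a S)).val.toRingHom).codRestrict (Polynomial.aeval a : Polynomial (acl S) →ₐ[acl S] ℂ).range
        (fun z => hle z.2))
  have hf : ∀ z, Polynomial.aeval a (f z) = (z : ℂ) := by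
    intro z
    have := e.apply_symm_apply ⟨z, hle z.2⟩
    exact congrArg Subtype.val this
  have hfi : Function.Injective f := by
    intro z w h
    have := congrArg (Polynomial.aeval a) h
    rw [hf, hf] at this
    exact Subtype.ext this
  refine ⟨p.map f, (Polynomial.map_ne_zero_iff hfi).2 hp, ?_⟩
  rw [ev2, Polynomial.eval₂_map, ← hpb, Polynomial.aeval_def]
  congr 1
  ext z
  exact hf z

lemma exists_biv_sep {S : Set ℂ} {a b : ℂ} (ha : a ∉ acl S) (hb : b ∈ acl (insert a S)) :
    ∃ g : Polynomial (Polynomial (acl S)), ev2 a b g = 0 ∧ ev2 a b (Polynomial.derivative g) ≠ 0 := by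
  classical
  obtain ⟨g, ⟨hg, hg0⟩, hmin⟩ := WellFounded.has_min (measure (fun g : Polynomial (Polynomial (acl S)) => g.natDegree)).wf
    {g | g ≠ 0 ∧ ev2 a b g = 0} (exists_biv ha hb)
  refine ⟨g, hg0, fun hd => ?_⟩
  by_cases h0 : g.natDegree = 0
  · rw [Polynomial.eq_C_of_natDegree_eq_zero h0, ev2, Polynomial.eval₂_C] at hg0
    apply transcendental_acl ha
    refine ⟨g.coeff 0, ?_, hg0⟩
    intro h
    apply hg
    rw [Polynomial.eq_C_of_natDegree_eq_zero h0, h, Polynomial.C_0]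
  · refine hmin (Polynomial.derivative g) ⟨?_, hd⟩ (Polynomial.natDegree_derivative_lt h0)
    intro h
    exact h0 (Polynomial.natDegree_eq_zero_of_derivative_eq_zero h)

section

lemma exists_tan {Q : Set V4} {S : Set ℂ} (hQ : Cur Q S) : ∃ T : V4 → V4, (∀ i, PF (acl S) (fun v => T v i)) ∧ 
    ∀ y ∈ Q, ¬ Rat S y → T y ≠ 0 ∧ T y 0 = 0 ∧ ∀ D : Derivation ℤ ℂ ℂ, Kills D S → ∃ a, ∀ i, D (y i) = a * T y i := by
  classical
  obtain ⟨x, hx, hxS⟩ := exists_gen hQ hQ.ctb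
  obtain ⟨j, hj⟩ := not_forall.1 hxS
  have hx1 := one_coord hQ hx hj
  have key : ∀ l, ∃ A B : V4 → ℂ, PF (acl S) A ∧ PF (acl S) B ∧ (l = j → ∀ y, A y = 1) ∧ (∀ y ∈ Q, ¬ Rat S y → B y ≠ 0) ∧
      ∀ D : Derivation ℤ ℂ ℂ, Kills D S → ∀ y ∈ Q, B y * D (y l) = A y * D (y j) := by
    intro l
    by_cases hl : l = j
    · subst hl
      exact ⟨fun _ => 1, fun _ => 1, PF.const (one_mem _), PF.const (one_mem _), fun _ _ => rfl, fun _ _ _ => one_ne_zero, fun _ _ _ _ => rfl⟩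
    obtain ⟨g, hg, hg'⟩ := exists_biv_sep hj (hx1 l)
    obtain ⟨A, hA⟩ := bider g
    have hgQ := f3 hQ subset_rfl (pf_ev2 g j l) hx hxS hg
    refine ⟨fun v => 0 - ev2 (v j) (v l) A, fun v => ev2 (v j) (v l) (Polynomial.derivative g), 
      (PF.const (zero_mem _)).sub (pf_ev2 _ _ _), pf_ev2 _ _ _, fun h => absurd h hl, ?_, ?_⟩
    · intro y hy hyS h
      exact hg' (f3 hQ subset_rfl (pf_ev2 _ j l) hy hyS h x hx)
    · intro D hD y hy
      have := hA D hD (y j) (y l)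
      rw [hgQ y hy, D.map_zero] at this
      linear_combination -this
  choose A B hA hB hAj hB0 hD using key
  have main : ∀ y ∈ Q, ¬ Rat S y → (fun l => A l y * ∏ m ∈ Finset.univ.erase l, B m y) ≠ (0 : V4) ∧ 
    ∀ D : Derivation ℤ ℂ ℂ, Kills D S → ∃ a, ∀ i, D (y i) = a * (A i y * ∏ m ∈ Finset.univ.erase i, B m y) := by
    intro y hy hyS
    have hB' : ∀ s : Finset (Fin 4), ∏ m ∈ s, B m y ≠ 0 := fun s => Finset.prod_ne_zero_iff.2 fun m _ => hB0 m y hy hyS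
    refine ⟨?_, ?_⟩
    · intro h
      have := congrFun h j
      simp only [hAj j rfl, one_mul] at this
      exact hB' _ this
    · intro D hDk
      refine ⟨D (y j) / ∏ m, B m y, fun i => ?_⟩
      rw [div_mul_eq_mul_div, eq_div_iff (hB' _), ← Finset.mul_prod_erase Finset.univ (fun m => B m y) (Finset.mem_univ i)]
      linear_combination (∏ m ∈ Finset.univ.erase i, B m y) * hD i D hDk y hy
  refine ⟨fun y l => A l y * ∏ m ∈ Finset.univ.erase l, B m y, fun i => (hA i).mul (PF.prod _ fun m => hB m), ?_⟩
  intro y hy hyS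
  refine ⟨(main y hy hyS).1, ?_, (main y hy hyS).2⟩
  obtain ⟨k, hk⟩ := not_forall.1 hyS
  obtain ⟨D, hDk, hDy⟩ := exists_kills hk
  obtain ⟨a, ha⟩ := (main y hy hyS).2 D hDk
  have h0 := ha 0
  rw [hQ.h0 y hy, D.map_one_eq_zero] at h0
  rcases mul_eq_zero.1 h0.symm with h | h
  · exact absurd (by rw [ha k, h, zero_mul]) hDy
  · exact h

/-- tangent lines do not pass through a fixed point -/
lemma no_fixed {Q : Set V4} {S : Set ℂ} (hQ : Cur Q S) {q : V4} (hq : Rat S q) (hq0 : q ≠ 0) {y : V4} (hy : y ∈ Q) {D : Derivation ℤ ℂ ℂ} (hD : Kills D S)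
    {j : Fin 4} (hj : D (y j) ≠ 0) {b s : ℂ} (h : ∀ i, D (y i) = b * q i + s * y i) : False := by
  have hjS : y j ∉ acl S := fun h => hj (hD _ h)
  have hyS : ¬ Rat S y := fun h => hjS (h j)
  obtain ⟨k, hk⟩ := Function.ne_iff.1 hq0
  simp only [Pi.zero_apply] at hk
  have hl : ∀ i, D (q k * y i - q i * y k) = s * (q k * y i - q i * y k) := by
    intro i
    rw [D.map_sub, D.leibniz, D.leibniz, hD _ (hq k), hD _ (hq i), h i, h k]
    simp only [smul_eq_mul]; ring
  obtain ⟨i, i', hi, hi', hii⟩ : ∃ i i' : Fin 4, i ≠ k ∧ i' ≠ k ∧ i ≠ i' := by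
    clear * - ; revert k; decide
  have hform : ∀ c ∈ acl S, (q k * y i' - q i' * y k) - c * (q k * y i - q i * y k) ≠ 0 := by
    intro c hc h0
    refine linform_ne hQ (a := q k • Pi.single i' 1 - q i' • Pi.single k 1 - c • (q k • Pi.single i 1 - q i • Pi.single k 1)) ?_ ?_ hy hyS ?_
    · intro m
      simp only [Pi.sub_apply, Pi.smul_apply, smul_eq_mul]
      have hs : ∀ n : Fin 4, (Pi.single n 1 : V4) m ∈ acl S := by
        intro n
        rw [Pi.single_apply]; split_ifs
        exacts [one_mem _, zero_mem _]
      exact sub_mem (sub_mem (mul_mem (hq _) (hs _)) (mul_mem (hq _) (hs _))) 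
        (mul_mem hc (sub_mem (mul_mem (hq _) (hs _)) (mul_mem (hq _) (hs _))))
    · intro he
      have := congrFun he i'
      simp [Pi.single_apply, hi', hii.symm, hk] at this
    · rw [← h0]
      simp [sub_mul, Finset.sum_sub_distrib, mul_sub, Pi.single_apply]
      ring
  have hne : q k * y i - q i * y k ≠ 0 := by
    intro h0
    refine linform_ne hQ (a := q k • Pi.single i 1 - q i • Pi.single k 1) ?_ ?_ hy hyS ?_
    · intro m
      simp only [Pi.sub_apply, Pi.smul_apply, smul_eq_mul]
      have hs : ∀ n : Fin 4, (Pi.single n 1 : V4) m ∈ acl S := by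
        intro n
        rw [Pi.single_apply]; split_ifs
        exacts [one_mem _, zero_mem _]
      exact (sub_mem (mul_mem (hq _) (hs _)) (mul_mem (hq _) (hs _)))
    · intro he
      have := congrFun he i
      simp [Pi.single_apply, hi, hk] at this
    · rw [← h0]
      simp [sub_mul, Finset.sum_sub_distrib, Pi.single_apply]
  set u := q k * y i - q i * y k with hu
  set w := q k * y i' - q i' * y k with hw
  have hcw : w / u * u = w := div_mul_cancel₀ _ hne
  have hDc : D (w / u) = 0 := by
    have := congrArg D hcw
    rw [D.leibniz, hl i, hl i'] at this
    simp only [smul_eq_mul] at this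
    have h2 : u * D (w / u) = 0 := by linear_combination this - s * hcw
    exact (mul_eq_zero.1 h2).resolve_left hne
  by_cases hc : w / u ∈ acl S
  · exact hform _ hc (by rw [hcw, sub_self])
  · have h1 := one_coord hQ hy hjS
    have hm : ∀ m, q m ∈ acl (insert (y j) S) := fun m => acl_mono (Set.subset_insert _ _) (hq m)
    have h2 : w / u ∈ acl (insert (y j) S) := 
      div_mem (sub_mem (mul_mem (hm _) (h1 _)) (mul_mem (hm _) (h1 _))) (sub_mem (mul_mem (hm _) (h1 _)) (mul_mem (hm _) (h1 _)))
    exact hj (kills_insert hD hDc _ (acl_exchange h2 hc))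

end


lemma li3_of {a b c : V4} (ha : a ≠ 0) (hb : ∀ α : ℂ, b ≠ α • a) (hc : ∀ α β : ℂ, c ≠ α • a + β • b) :
    LinearIndependent ℂ ![a, b, c] := by
  have h2 : LinearIndependent ℂ ![a, b] := (LinearIndependent.pair_iff' ha).2 fun α h => hb α h.symm
  have h3 : c ∉ Submodule.span ℂ (Set.range ![a, b]) := by
    intro hd
    obtain ⟨w, hw⟩ := (Submodule.mem_span_range_iff_exists_fun ℂ).1 hd
    apply hc (w 0) (w 1)
    rw [← hw, Fin.sum_univ_two]
    rfl
  have := linearIndependent_finSnoc.2 ⟨h2, h3⟩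
  have e : (Fin.snoc ![a, b] c : Fin 3 → V4) = ![a, b, c] := by
    funext i; fin_cases i <;> rfl
  rwa [← e]

lemma li3_coeff {a b c : V4} (hne : LinearIndependent ℂ ![a, b, c]) {α β γ : ℂ} 
    (h : α • a + β • b + γ • c = 0) : α = 0 ∧ β = 0 ∧ γ = 0 := by
  have := Fintype.linearIndependent_iff.1 hne ![α, β, γ] (by
    rw [Fin.sum_univ_three]; exact h)
  exact ⟨this 0, this 1, this 2⟩

/-- coefficients with respect to rational vectors are rational -/
lemma coeff_rat {S : Set ℂ} {a b c d : V4} (hne : LinearIndependent ℂ ![a, b, c]) {α β γ : ℂ} 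
    (h : d = α • a + β • b + γ • c) (ha : Rat S a) (hb : Rat S b) (hc : Rat S c) (hd : Rat S d) : γ ∈ acl S := by
  by_contra hcon
  obtain ⟨D, hD, hDγ⟩ := exists_kills hcon
  apply hDγ
  refine (li3_coeff hne (α := D α) (β := D β) ?_).2.2
  ext i
  have h2 := congrArg D (congrFun h i)
  simp only [Pi.add_apply, Pi.smul_apply, smul_eq_mul, D.map_add, D.leibniz, hD _ (ha i), hD _ (hb i), hD _ (hc i), hD _ (hd i)] at h2
  simp only [Pi.add_apply, Pi.smul_apply, smul_eq_mul, Pi.zero_apply]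
  linear_combination -h2

lemma span_of_dt {a b c d : V4} (h : LinearIndependent ℂ ![a, b, c]) (h0 : dt a b c d = 0) :
    ∃ α β γ : ℂ, d = α • a + β • b + γ • c := by
  by_contra hcon
  push Not at hcon
  have : d ∉ Submodule.span ℂ (Set.range ![a, b, c]) := by
    intro hd
    obtain ⟨w, hw⟩ := (Submodule.mem_span_range_iff_exists_fun ℂ).1 hd
    apply hcon (w 0) (w 1) (w 2)
    rw [← hw, Fin.sum_univ_three]
    rfl
  have := linearIndependent_finSnoc.2 ⟨h, this⟩
  have e : (Fin.snoc ![a, b, c] d : Fin 4 → V4) = ![a, b, c, d] := by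
    funext i; fin_cases i <;> rfl
  rw [e] at this
  exact dt_ne_zero_iff.2 this h0

lemma dt_zero_of {a b c d : V4} {α β γ δ : ℂ} (h : α • a + β • b + γ • c + δ • d = 0) (hb : β ≠ 0) : dt a b c d = 0 := by
  by_contra hne
  have := Fintype.linearIndependent_iff.1 (dt_ne_zero_iff.1 hne) ![α, β, γ, δ] (by
    rw [Fin.sum_univ_four]; exact h) 1
  exact hb this

lemma li4_coeff {a b c d : V4} (hne : LinearIndependent ℂ ![a, b, c, d]) {α β γ δ : ℂ} 
    (h : α • a + β • b + γ • c + δ • d = 0) : α = 0 ∧ β = 0 ∧ γ = 0 ∧ δ = 0 := by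
  have := Fintype.linearIndependent_iff.1 hne ![α, β, γ, δ] (by
    rw [Fin.sum_univ_four]; exact h)
  exact ⟨this 0, this 1, this 2, this 3⟩

section

lemma li_tan {Q : Set V4} {S : Set ℂ} (hQ : Cur Q S) {T : V4} {x y : V4} (hx : x ∈ Q) (hy : y ∈ Q) (hT0 : T ≠ 0) (hT : T 0 = 0) (hxS : Rat S x) (hTS : Rat S T)
    (hyS : ¬ Rat S y) : LinearIndependent ℂ ![x, T, y] := by
  refine li3_of (ne_zero_of_mem hQ hx) ?_ (notin_span2 hQ hxS hTS hy hyS)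
  intro α h
  have := congrFun h 0
  rw [hT, Pi.smul_apply, hQ.h0 x hx, smul_eq_mul, mul_one] at this
  rw [← this, zero_smul] at h
  exact hT0 h

lemma PF.rat {Q : Set V4} {S : Set ℂ} (hQ : Cur Q S) {T : Set ℂ} {f : V4 → ℂ} (hf : PF (acl T) f) {x : V4} (hx : Rat T x) : f x ∈ acl T := by
  obtain ⟨P, hP⟩ := hf
  rw [hP]
  have := aeval_algebraMap_apply ℂ (fun i => (⟨x i, hx i⟩ : acl T)) P
  have e : (algebraMap (acl T) ℂ ∘ fun i => (⟨x i, hx i⟩ : acl T)) = x := rfl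
  rw [e] at this
  rw [this]
  exact ((aeval fun i => (⟨x i, hx i⟩ : acl T)) P).2

lemma lemU {Q : Set V4} {S : Set ℂ} (hQ : Cur Q S) {T : V4 → V4} (hT : ∀ i, PF (acl S) (fun v => T v i)) 
    (hT' : ∀ y ∈ Q, ¬ Rat S y → T y ≠ 0 ∧ T y 0 = 0 ∧ ∀ D : Derivation ℤ ℂ ℂ, Kills D S → ∃ a, ∀ i, D (y i) = a * T y i)
    (hz : ∀ x ∈ Q, ∀ y ∈ Q, dt x (T x) y (T y) = 0) : False := by
  obtain ⟨x, hx, hxS⟩ := exists_gen hQ hQ.ctb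
  have hQ1 := hQ.adj x
  obtain ⟨y, hy, hyS⟩ := exists_gen hQ1 hQ1.ctb
  have hQ2 := hQ1.adj y
  obtain ⟨z, hz', hzS⟩ := exists_gen hQ2 hQ2.ctb
  obtain ⟨hyS0, hxy⟩ := indep_symm hQ hx hy hxS hyS
  have hzS0 : ¬ Rat S z := fun h => hzS (h.mono ((sub_adj _ _).trans (sub_adj _ _)))
  obtain ⟨x1, x2, -⟩ := hT' x hx hxS
  obtain ⟨y1, y2, -⟩ := hT' y hy hyS0
  obtain ⟨z1, z2, z3⟩ := hT' z hz' hzS0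
  have hTx : Rat (adj S x) (T x) := fun i => PF.rat hQ ((hT i).mono (acl_mono (sub_adj _ _))) (rat_adj S x)
  have hTy : Rat (adj (adj S x) y) (T y) := fun i => 
    PF.rat hQ ((hT i).mono (acl_mono ((sub_adj _ _).trans (sub_adj _ _)))) (rat_adj _ y)
  have l1 := li_tan hQ1 hx hy x1 x2 (rat_adj _ _) hTx hyS
  have l2 := li_tan hQ2 hx hz' x1 x2 ((rat_adj _ _).mono (sub_adj _ _)) (hTx.mono (sub_adj _ _)) hzS
  have l3 := li_tan hQ2 hy hz' y1 y2 (rat_adj _ _) hTy hzS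
  have l4 := dt_ne_zero_iff.1 (dt_ne hQ2 ((rat_adj _ _).mono (sub_adj _ _)) (hTx.mono (sub_adj _ _)) (rat_adj _ _) l1 hz' hzS)
  obtain ⟨α, β, γ, e1⟩ := span_of_dt l1 (hz x hx y hy)
  obtain ⟨a, b, c, e2⟩ := span_of_dt l2 (hz x hx z hz')
  obtain ⟨a', b', c', e3⟩ := span_of_dt l3 (hz y hy z hz')
  have e4 := li4_coeff l4 (α := a - b' * α) (β := b - b' * β) (γ := - a' - b' * γ) (δ := c - c') (by
    have : (a • x + b • T x + c • z) - (a' • y + b' • T y + c' • z) = 0 := by rw [← e2, ← e3, sub_self]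
    rw [e1] at this
    rw [← this]
    module)
  obtain ⟨f1, f2, f3, f4⟩ := e4
  -- the fixed point `T y - γ y`
  have hγ : γ ∈ acl (adj (adj S x) y) :=
    coeff_rat l1 e1 ((rat_adj _ _).mono (sub_adj _ _)) (hTx.mono (sub_adj _ _)) (rat_adj _ _) hTy
  have hq0 : T y - γ • y ≠ 0 := by
    intro h
    have := congrFun h 0
    simp [y2, hQ.h0 y hy] at this
    rw [this] at h
    simp at h
    exact y1 h
  obtain ⟨j, hj⟩ := not_forall.1 hzS
  obtain ⟨D, hD, hDz⟩ := exists_kills hj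
  obtain ⟨r, hr⟩ := z3 D (hD.mono ((sub_adj _ _).trans (sub_adj _ _)))
  refine no_fixed hQ2 (q := T y - γ • y) ?_ hq0 hz' hD hDz (b := r * b') (s := r * c) ?_
  · intro i
    exact sub_mem (hTy i) (mul_mem hγ (rat_adj _ y i))
  · intro i
    rw [hr i]
    have e5 := congrFun e3 i
    simp only [Pi.add_apply, Pi.smul_apply, smul_eq_mul, Pi.sub_apply] at e5 ⊢
    rw [e5]
    linear_combination (-r * y i) * f3 - r * z i * f4

lemma lemT {Q : Set V4} {S : Set ℂ} (hQ : Cur Q S) {S' : Set ℂ} (hS : S ⊆ S') (hc : S'.Countable) {p x y : V4} (hp : Rat S' p) (hx : x ∈ Q) (hy : y ∈ Q) {a b : ℂ}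
    (hb : b ≠ 0) (h : y = a • p + b • x) (hxS' : ¬ Rat S' x) (hyS : ¬ Rat (adj S x) y) : False := by
  have hxS : ¬ Rat S x := fun h => hxS' (h.mono hS)
  obtain ⟨hyS0, -⟩ := indep_symm hQ hx hy hxS hyS
  obtain ⟨T, hT, hT'⟩ := exists_tan hQ
  have ha : a ≠ 0 := by
    rintro rfl
    apply hyS
    have := congrFun h 0
    simp [hQ.h0 x hx, hQ.h0 y hy] at this
    rw [← this] at h
    simp at h
    rw [h]; exact rat_adj _ _
  obtain ⟨j, hj⟩ := not_forall.1 hxS'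
  obtain ⟨D, hD, hDx⟩ := exists_kills hj
  obtain ⟨r, hr⟩ := (hT' x hx hxS).2.2 D (hD.mono hS)
  obtain ⟨s, hs⟩ := (hT' y hy hyS0).2.2 D (hD.mono hS)
  have hr0 : r ≠ 0 := by
    rintro rfl
    exact hDx (by rw [hr, zero_mul])
  refine lemU hQ hT hT' (p2 hQ (G := fun x y => dt x (T x) y (T y)) ?_ ?_ hx hy hxS hyS ?_)
  · intro U hU x hx
    exact PF.dt (fun j => PF.const (hx j)) (fun j => PF.const (PF.rat hQ ((hT j).mono (acl_mono hU)) hx))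
      (fun j => PF.coord _ j) (fun j => (hT j).mono (acl_mono hU))
  · intro U hU x hx
    exact PF.dt (fun j => PF.coord _ j) (fun j => (hT j).mono (acl_mono hU))
      (fun j => PF.const (hx j)) (fun j => PF.const (PF.rat hQ ((hT j).mono (acl_mono hU)) hx))
  · refine dt_zero_of (α := D b - D a / a * b) (β := b * r) (γ := D a / a) (δ := - s) ?_ (mul_ne_zero hb hr0)
    ext i
    have h1 := congrFun h i
    have h2 := congrArg D h1
    simp only [Pi.add_apply, Pi.smul_apply, smul_eq_mul, D.map_add, D.leibniz, hD _ (hp i), hr i, hs i] at h1 h2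
    simp only [Pi.add_apply, Pi.smul_apply, smul_eq_mul, Pi.zero_apply]
    rw [h1]
    field_simp
    linear_combination (-a) * h2

lemma trisec {Q : Set V4} {S : Set ℂ} (hQ : Cur Q S) {x y z : V4} (hx : x ∈ Q) (hy : y ∈ Q) (hz : z ∈ Q) (hxS : ¬ Rat S x) (hyS : ¬ Rat (adj S x) y)
    {a b : ℂ} (h : z = a • x + b • y) : z = x ∨ z = y := by
  have h0 := congrFun h 0
  simp [hQ.h0 x hx, hQ.h0 y hy, hQ.h0 z hz] at h0
  by_cases hb : b = 0
  · left
    rw [hb, add_zero] at h0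
    rw [h, hb, ← h0]; simp
  by_cases ha : a = 0
  · right
    rw [ha, zero_add] at h0
    rw [h, ha, ← h0]; simp
  exfalso
  have e : y = b⁻¹ • z + (-a / b) • x := by
    rw [h]
    ext i
    simp only [Pi.add_apply, Pi.smul_apply, smul_eq_mul]
    field_simp; ring
  refine lemT hQ (sub_adj S z) (adj_countable hQ.ctb z) (rat_adj S z) hx hy (div_ne_zero (neg_ne_zero.2 ha) hb) e ?_ hyS
  intro hr
  exact notin_span2 (hQ.adj x) (exch hQ hx hz hr hxS) (rat_adj _ _) hy hyS _ _ e

lemma claimA {Q : Set V4} {S : Set ℂ} (hQ : Cur Q S) {x1 x2 x3 x4 : V4} (h1 : x1 ∈ Q) (h2 : x2 ∈ Q) (h3 : x3 ∈ Q) (h4 : x4 ∈ Q) (i1 : ¬ Rat S x1)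
    (i2 : ¬ Rat (adj S x1) x2) (i3 : ¬ Rat (adj (adj S x1) x2) x3) {a b c : ℂ} (h : x4 = a • x1 + b • x2 + c • x3) :
    x4 = x1 ∨ x4 = x2 ∨ x4 = x3 := by
  have i2' : ¬ Rat S x2 := fun h => i2 (h.mono (sub_adj _ _))
  have i31 : ¬ Rat (adj S x1) x3 := fun h => i3 (h.mono (sub_adj _ _))
  have i32 : ¬ Rat (adj S x2) x3 := fun h => i3 (h.mono (adj_mono (sub_adj _ _) _))
  by_cases hc : c = 0
  · rcases trisec hQ h1 h2 h4 i1 i2 (a := a) (b := b) (by rw [h, hc]; simp) with h | h <;> tauto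
  by_cases hb : b = 0
  · rcases trisec hQ h1 h3 h4 i1 i31 (a := a) (b := c) (by rw [h, hb]; simp) with h | h <;> tauto
  by_cases ha : a = 0
  · rcases trisec hQ h2 h3 h4 i2' i32 (a := b) (b := c) (by rw [h, ha]; simp) with h | h <;> tauto
  by_cases h34 : x3 = x4
  · tauto
  have h12 : x1 ≠ x2 := by rintro rfl; exact i2 (rat_adj _ _)
  exfalso
  by_cases ht : b / a ∈ acl (adj (adj S x1) x2)
  · refine lemT hQ ((sub_adj S x1).trans (sub_adj _ x2)) (adj_countable (adj_countable hQ.ctb _) _) (p := x1 + (b / a) • x2) ?_ h3 h4 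
      (a := a) (b := c) hc ?_ i3 ?_
    · intro i
      exact add_mem ((rat_adj _ _).mono (sub_adj _ _) i) (mul_mem ht (rat_adj _ _ i))
    · rw [h]; ext i
      simp only [Pi.add_apply, Pi.smul_apply, smul_eq_mul]
      field_simp
    · intro hr
      have j2 := (indep_symm (hQ.adj x1) h2 h3 i2 i3).2
      refine notin_span3 ((hQ.adj x1).adj x3) ((rat_adj S x1).mono (sub_adj _ _)) (rat_adj _ x3) (hr.mono (adj_mono (sub_adj _ _) _)) h2 j2
        (-a / b) (-c / b) (b⁻¹) ?_
      rw [h]; ext i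
      simp only [Pi.add_apply, Pi.smul_apply, smul_eq_mul]
      field_simp; ring
  · obtain ⟨p, hp1, hp2⟩ := sec_gen hQ
    obtain ⟨c', d', e⟩ := hp2 x1 h1 x2 h2 x3 h3 x4 h4 h12 h34 (b / a) (-c / a) (a⁻¹) (hp1 x1 h1 x2 h2 i1 i2 _ ht) (by
      rw [h]; ext i
      simp only [Pi.add_apply, Pi.smul_apply, smul_eq_mul]
      field_simp; ring)
    exact notin_span2 ((hQ.adj x1).adj x2) ((rat_adj S x1).mono (sub_adj _ _)) (rat_adj _ x2) h3 i3 _ _ e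

end


/-- evaluation of a linear form -/
def lf (a v : V4) : ℂ := ∑ i, a i * v i

lemma lf_add (a v w : V4) : lf a (v + w) = lf a v + lf a w := by
  simp only [lf, Pi.add_apply, mul_add, Finset.sum_add_distrib]
lemma lf_smul (a v : V4) (c : ℂ) : lf a (c • v) = c * lf a v := by
  simp only [lf, Pi.smul_apply, smul_eq_mul, Finset.mul_sum]
  exact Finset.sum_congr rfl fun i _ => by ring
lemma lf_sub_left (a b v : V4) (c : ℂ) : lf (a - c • b) v = lf a v - c * lf b v := by
  simp only [lf, Pi.sub_apply, Pi.smul_apply, smul_eq_mul, Finset.mul_sum, ← Finset.sum_sub_distrib]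
  exact Finset.sum_congr rfl fun i _ => by ring
lemma lf_mem {S : Set ℂ} {a v : V4} (ha : Rat S a) (hv : Rat S v) : lf a v ∈ acl S :=
  sum_mem fun i _ => mul_mem (ha i) (hv i)

lemma exists_forms {S : Set ℂ} {x y : V4} (hx : Rat S x) (hy : Rat S y) (hx0 : x 0 = 1) (hy0 : y 0 = 1) (hxy : x ≠ y) :
    ∃ a b : V4, Rat S a ∧ Rat S b ∧ b ≠ 0 ∧ (∀ c : ℂ, a - c • b ≠ 0) ∧ lf b x = 0 ∧ lf b y = 0 ∧
      ∀ v, lf a v = 0 → lf b v = 0 → ∃ α β : ℂ, v = α • x + β • y := by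
  obtain ⟨k, hk⟩ := Function.ne_iff.1 hxy
  have hk0 : k ≠ 0 := by rintro rfl; exact hk (hx0.trans hy0.symm)
  obtain ⟨i, j, hi0, hj0, hik, hjk, hij, hall⟩ : ∃ i j : Fin 4, i ≠ 0 ∧ j ≠ 0 ∧ i ≠ k ∧ j ≠ k ∧ i ≠ j ∧ ∀ m, m = 0 ∨ m = k ∨ m = i ∨ m = j := by
    clear * - hk0; revert k; decide
  have hd : y k - x k ≠ 0 := sub_ne_zero.2 (Ne.symm hk)
  let F : Fin 4 → V4 := fun i => 
    Pi.single i (y k - x k) - Pi.single k (y i - x i) + Pi.single 0 ((y i - x i) * x k - (y k - x k) * x i)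
  have hF : ∀ i v, lf (F i) v = (y k - x k) * (v i - v 0 * x i) - (y i - x i) * (v k - v 0 * x k) := by
    intro i v
    simp [lf, F, add_mul, sub_mul, Finset.sum_add_distrib, Finset.sum_sub_distrib, Pi.single_apply]
    ring
  have hFr : ∀ i, Rat S (F i) := by
    intro i m
    have hs : ∀ n : Fin 4, ∀ c ∈ acl S, (Pi.single n c : V4) m ∈ acl S := by
      intro n c hc
      rw [Pi.single_apply]; split_ifs
      exacts [hc, zero_mem _]
    exact add_mem (sub_mem (hs _ _ (sub_mem (hy _) (hx _))) (hs _ _ (sub_mem (hy _) (hx _)))) 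
      (hs _ _ (sub_mem (mul_mem (sub_mem (hy _) (hx _)) (hx _)) (mul_mem (sub_mem (hy _) (hx _)) (hx _))))
  refine ⟨F i, F j, hFr i, hFr j, ?_, ?_, ?_, ?_, ?_⟩
  · intro h
    have := congrFun h j
    simp [F, Pi.single_apply, hjk, hj0] at this
    exact hd this
  · intro c h
    have := congrFun h i
    simp [F, Pi.single_apply, hik, hi0, hij] at this
    exact hd this
  · rw [hF, hx0]; ring
  · rw [hF, hy0]; ring
  · intro v h1 h2
    rw [hF] at h1 h2
    refine ⟨v 0 - (v k - v 0 * x k) / (y k - x k), (v k - v 0 * x k) / (y k - x k), ?_⟩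
    ext m
    simp only [Pi.add_apply, Pi.smul_apply, smul_eq_mul]
    rcases hall m with rfl | rfl | rfl | rfl
    · rw [hx0, hy0]; ring
    · field_simp; ring
    · field_simp; linear_combination h1
    · field_simp; linear_combination h2

lemma isAlg_adjoin {S : Set ℂ} {u b : ℂ} (hu : u ∉ acl S) (hb : b ∈ acl (insert u S)) :
    IsAlgebraic (IntermediateField.adjoin (acl S) {u}) b := by
  obtain ⟨g, hg, hg0⟩ := exists_biv hu hb
  set F := IntermediateField.adjoin (acl S) {u} with hF
  let φ : Polynomial (acl S) →ₐ[acl S] F := Polynomial.aeval (IntermediateField.AdjoinSimple.gen (acl S) u)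
  have hφ : ∀ p, ((φ p : F) : ℂ) = Polynomial.aeval u p := by
    intro p
    have := Polynomial.aeval_algebraMap_apply ℂ (IntermediateField.AdjoinSimple.gen (acl S) u) p
    rw [IntermediateField.AdjoinSimple.algebraMap_gen] at this
    exact this.symm
  have hinj : Function.Injective φ.toRingHom := by
    intro p q h
    have h2 := congrArg (fun z : F => (z : ℂ)) h
    have h3 : ((φ p : F) : ℂ) = ((φ q : F) : ℂ) := h2
    rw [hφ, hφ] at h3
    exact transcendental_iff_injective.1 (transcendental_acl hu) h3
  refine ⟨g.map φ.toRingHom, (Polynomial.map_ne_zero_iff hinj).2 hg, ?_⟩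
  rw [Polynomial.aeval_def, Polynomial.eval₂_map, ← hg0, ev2]
  congr 1
  exact RingHom.ext fun p => hφ p

lemma galois_fix {K L : Type} [Field K] [Field L] [Algebra K L] [IsAlgClosed L] [CharZero K] {ι : Type} (x : ι → L)
    (hx : ∀ i, IsAlgebraic K (x i))
    (h : ∀ y : ι → L, (∀ p : MvPolynomial ι K, aeval x p = 0 ↔ aeval y p = 0) → y = x) (i : ι) :
    ∃ z : K, algebraMap K L z = x i := by
  let E := algebraicClosure K L
  have hxE : ∀ i, x i ∈ E := fun i => mem_algebraicClosure_iff.2 (hx i)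
  haveI : IsAlgClosure K E := algebraicClosure.isAlgClosure K L
  haveI : IsGalois K E := IsAlgClosure.isGalois K E
  let xE : ι → E := fun i => ⟨x i, hxE i⟩
  have hfix : ∀ σ : E ≃ₐ[K] E, σ (xE i) = xE i := by
    intro σ
    have key := h (fun i => (σ (xE i) : L)) (by
      intro p
      let ψ : E →ₐ[K] L := E.val.comp (σ : E →ₐ[K] E)
      have e1 : aeval x p = E.val (aeval xE p) := by
        rw [← AlgHom.comp_apply, MvPolynomial.comp_aeval]; rfl
      have e2 : aeval (fun i => (σ (xE i) : L)) p = ψ (aeval xE p) := by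
        rw [← AlgHom.comp_apply, MvPolynomial.comp_aeval]; rfl
      rw [e1, e2, map_eq_zero_iff E.val E.val.injective, map_eq_zero_iff ψ ψ.injective])
    exact Subtype.ext (congrFun key i)
  have : xE i ∈ (⊥ : IntermediateField K E) := (InfiniteGalois.mem_bot_iff_fixed (xE i)).2 hfix
  obtain ⟨z, hz⟩ := IntermediateField.mem_bot.1 this
  exact ⟨z, congrArg (fun w : E => (w : L)) hz⟩

lemma rational_param {Q : Set V4} {S0 : Set ℂ} (hQ0 : Cur Q S0) : ∃ (S : Set ℂ) (a b : V4) (x : V4) (u : ℂ) (f : Fin 4 → Polynomial (acl S)), 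
    Cur Q S ∧ Rat S a ∧ Rat S b ∧ x ∈ Q ∧ ¬ Rat S x ∧ lf b x ≠ 0 ∧ lf a x = u * lf b x ∧ u ∉ acl S ∧
    f 0 ≠ 0 ∧ ∀ i, x i * Polynomial.aeval u (f 0) = Polynomial.aeval u (f i) := by
  classical
  obtain ⟨x1, h1, i1⟩ := exists_gen hQ0 hQ0.ctb
  obtain ⟨x2, h2, i2⟩ := exists_gen (hQ0.adj x1) (hQ0.adj x1).ctb
  set S := adj (adj S0 x1) x2 with hS
  have hQ : Cur Q S := (hQ0.adj x1).adj x2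
  obtain ⟨x, hx, hxS⟩ := exists_gen hQ hQ.ctb
  have h12 : x1 ≠ x2 := by rintro rfl; exact i2 (rat_adj _ _)
  obtain ⟨a, b, ha, hb, hb0, hab, hb1, hb2, hspan⟩ := exists_forms (S := S) ((rat_adj S0 x1).mono (sub_adj _ _)) (rat_adj _ x2) 
    (hQ.h0 _ h1) (hQ.h0 _ h2) h12
  have hbx : lf b x ≠ 0 := linform_ne hQ hb hb0 hx hxS
  set u := lf a x / lf b x with hu
  have hux : lf a x = u * lf b x := (div_mul_cancel₀ _ hbx).symm
  have huS : u ∉ acl S := by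
    intro h
    refine linform_ne hQ (a := a - u • b) (fun i => sub_mem (ha i) (mul_mem h (hb i))) (hab u) hx hxS ?_
    have := lf_sub_left a b x u
    rw [lf] at this
    rw [this, hux, sub_self]
  obtain ⟨j, hj⟩ := not_forall.1 hxS
  have hr1 := one_coord hQ hx hj
  have hum : u ∈ acl (insert (x j) S) := 
    div_mem (lf_mem (ha.mono (Set.subset_insert _ _)) hr1) (lf_mem (hb.mono (Set.subset_insert _ _)) hr1)
  have hxj := acl_exchange hum huS
  have hxu : ∀ i, x i ∈ acl (insert u S) := fun i => acl_le (by
    rintro z (rfl | hz)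
    · exact hxj
    · exact subset_acl _ (Or.inr hz)) (hr1 i)
  set F := IntermediateField.adjoin (acl S) {u} with hF
  have hxF : ∀ i, ∃ z : F, algebraMap F ℂ z = x i := by
    refine galois_fix x (fun i => isAlg_adjoin huS (hxu i)) ?_
    intro y hy
    let KF : acl S →+* F := algebraMap (acl S) F
    have hKF : (algebraMap F ℂ).comp KF = algebraMap (acl S) ℂ := rfl
    have hpf : ∀ p : MvPolynomial (Fin 4) (acl S), aeval x p = 0 → aeval y p = 0 := by
      intro p hp
      have e : ∀ z : V4, aeval z (MvPolynomial.map KF p) = aeval z p := by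
        intro z
        rw [aeval_def, eval₂_map, hKF, aeval_def]
      have := (hy (MvPolynomial.map KF p))
      rw [e, e] at this
      exact this.1 hp
    let uF : F := IntermediateField.AdjoinSimple.gen (acl S) u
    have huF : algebraMap F ℂ uF = u := IntermediateField.AdjoinSimple.algebraMap_gen (acl S) u
    let P : ∀ d : V4, Rat S d → MvPolynomial (Fin 4) F := fun d hd => ∑ i, MvPolynomial.C (KF ⟨d i, hd i⟩) * MvPolynomial.X i
    have hP : ∀ d hd, ∀ z : V4, aeval z (P d hd) = lf d z := by
      intro d hd z
      simp only [P, map_sum, map_mul, aeval_C, aeval_X]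
      rfl
    have hyQ : y ∈ Q := by
      obtain ⟨E, hE1, hE2⟩ := hQ.eqs
      rw [hE2]
      intro g hg
      obtain ⟨p, hp⟩ := hE1 g hg
      rw [hp]
      apply hpf
      rw [← hp]
      exact (hE2 x).1 hx g hg
    have hby : lf b y ≠ 0 := by
      have := hy (P b hb)
      rw [hP, hP] at this
      exact fun h => hbx (this.2 h)
    have huy : lf a y = u * lf b y := by
      have := hy (P a ha - MvPolynomial.C uF * P b hb)
      simp only [map_sub, map_mul, aeval_C, hP, huF] at this
      exact sub_eq_zero.1 (this.1 (sub_eq_zero.2 hux))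
    have hlin : ∃ α β : ℂ, y - (lf b y / lf b x) • x = α • x1 + β • x2 := by
      apply hspan
      · rw [sub_eq_add_neg, ← neg_smul, lf_add, lf_smul, hux, huy]; field_simp; ring
      · rw [sub_eq_add_neg, ← neg_smul, lf_add, lf_smul]; field_simp; ring
    obtain ⟨α, β, hl⟩ := hlin
    have hyx : y = x := by
      rcases claimA hQ0 h1 h2 hx hyQ i1 i2 hxS (a := α) (b := β) (c := lf b y / lf b x) (by rw [← hl]; abel) with h | h | h
      · rw [h] at hby; exact absurd hb1 hby
      · rw [h] at hby; exact absurd hb2 hby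
      · exact h
    exact hyx
  have hrs : ∀ i, ∃ r s : Polynomial (acl S), s ≠ 0 ∧ x i * Polynomial.aeval u s = Polynomial.aeval u r := by
    intro i
    obtain ⟨r, s, h⟩ := (IntermediateField.mem_adjoin_simple_iff (acl S) (x i)).1 (by obtain ⟨z, hz⟩ := hxF i; rw [← hz]; exact z.2)
    by_cases hs : s = 0
    · refine ⟨0, 1, one_ne_zero, ?_⟩
      rw [h, hs]; simp
    · refine ⟨r, s, hs, ?_⟩
      rw [h, div_mul_cancel₀]
      intro h0
      exact transcendental_acl huS ⟨s, hs, h0⟩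
  choose r s hs hrs using hrs
  refine ⟨S, a, b, x, u, fun i => if i = 0 then ∏ m, s m else r i * ∏ m ∈ Finset.univ.erase i, s m, hQ, ha, hb, hx, hxS, hbx, hux, huS, ?_, ?_⟩
  · simp only [if_true]
    exact Finset.prod_ne_zero_iff.2 fun m _ => hs m
  · intro i
    by_cases hi : i = 0
    · subst hi; rw [hQ.h0 x hx, one_mul]
    · simp only [if_true, hi, if_false]
      rw [← Finset.mul_prod_erase Finset.univ s (Finset.mem_univ i), map_mul, map_mul, ← hrs i]
      ring


/-- value of a polynomial vector -/
def fv {K : Subfield ℂ} (f : Fin 4 → Polynomial K) (c : ℂ) : V4 := fun i => Polynomial.aeval c (f i)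

lemma fv_pf {K : Subfield ℂ} (f : Fin 4 → Polynomial K) (i : Fin 4) : PF1 K (fun c => fv f c i) := ⟨f i, fun _ => rfl⟩

lemma min_param {K : Subfield ℂ} {x : V4} {u : ℂ} (hu : ∀ p : Polynomial K, p ≠ 0 → Polynomial.aeval u p ≠ 0)
    (halg : ∀ p : Polynomial K, p ≠ 0 → ∀ c : ℂ, Polynomial.aeval c p = 0 → c ∈ K) : ∀ (n : ℕ) (f : Fin 4 → Polynomial K), (f 0).natDegree = n → f 0 ≠ 0 →
    (∀ i, x i * Polynomial.aeval u (f 0) = Polynomial.aeval u (f i)) → 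
    ∃ f : Fin 4 → Polynomial K, f 0 ≠ 0 ∧ (∀ i, x i * Polynomial.aeval u (f 0) = Polynomial.aeval u (f i)) ∧ ∀ c, fv f c ≠ 0 := by
  intro n
  induction n using Nat.strong_induction_on with
  | _ n ih =>
  intro f hn h0 hf
  by_cases h : ∀ c, fv f c ≠ 0
  · exact ⟨f, h0, hf, h⟩
  push Not at h
  obtain ⟨c, hc⟩ := h
  have hcK : c ∈ K := halg _ h0 c (congrFun hc 0)
  have hd : ∀ i, ∃ q, f i = (Polynomial.X - Polynomial.C (⟨c, hcK⟩ : K)) * q := by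
    intro i
    apply Polynomial.dvd_iff_isRoot.2
    have h1 := congrFun hc i
    change Polynomial.aeval (algebraMap K ℂ ⟨c, hcK⟩) (f i) = 0 at h1
    rw [Polynomial.aeval_algebraMap_apply, map_eq_zero] at h1
    simpa using h1
  choose q hq using hd
  have hX : (Polynomial.X - Polynomial.C (⟨c, hcK⟩ : K)) ≠ 0 := Polynomial.X_sub_C_ne_zero _
  have hq0 : q 0 ≠ 0 := by
    intro h; apply h0; rw [hq, h, mul_zero]
  refine ih (q 0).natDegree ?_ q rfl hq0 ?_
  · rw [← hn, hq 0, Polynomial.natDegree_mul hX hq0, Polynomial.natDegree_X_sub_C]; omega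
  · intro i
    have := hf i
    rw [hq 0, hq i, map_mul, map_mul] at this
    apply mul_left_cancel₀ (hu _ hX)
    linear_combination this

structure Par (Q : Set V4) (S : Set ℂ) (a b : V4) (f : Fin 4 → Polynomial (acl S)) : Prop where
  cur : Cur Q S
  ha : Rat S a
  hb : Rat S b
  f0 : f 0 ≠ 0
  nz : ∀ c, fv f c ≠ 0
  rel : ∀ c, lf a (fv f c) = c * lf b (fv f c)
  mem : ∀ c, fv f c 0 ≠ 0 → (fv f c 0)⁻¹ • fv f c ∈ Q
  hb0 : ∀ c, c ∉ acl S → lf b (fv f c) ≠ 0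

lemma lf_pf {S : Set ℂ} {a : V4} (ha : Rat S a) : PF (acl S) (lf a) := by
  refine ⟨∑ i, MvPolynomial.C ⟨a i, ha i⟩ * MvPolynomial.X i, fun v => ?_⟩
  simp only [map_sum, map_mul, aeval_C, aeval_X]
  rfl

lemma clear_den {K : Subfield ℂ} (f : Fin 4 → Polynomial K) (p : MvPolynomial (Fin 4) K) :
    ∃ (N : ℕ) (R : Polynomial K), ∀ c, fv f c 0 ≠ 0 → 
      (fv f c 0) ^ N * aeval ((fv f c 0)⁻¹ • fv f c) p = Polynomial.aeval c R := by
  induction p using MvPolynomial.induction_on with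
  | C a => exact ⟨0, Polynomial.C a, fun c _ => by simp⟩
  | add p q hp hq =>
    obtain ⟨N, R, h1⟩ := hp
    obtain ⟨N', R', h2⟩ := hq
    refine ⟨N + N', R * f 0 ^ N' + R' * f 0 ^ N, fun c hc => ?_⟩
    have e : Polynomial.aeval c (f 0) = fv f c 0 := rfl
    rw [map_add, map_add, map_mul, map_mul, ← h1 c hc, ← h2 c hc, map_pow, map_pow, e]
    ring
  | mul_X p i hp =>
    obtain ⟨N, R, h1⟩ := hp
    refine ⟨N + 1, R * f i, fun c hc => ?_⟩
    have e : Polynomial.aeval c (f i) = fv f c i := rfl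
    rw [map_mul, map_mul, ← h1 c hc, aeval_X, e, Pi.smul_apply, smul_eq_mul, pow_succ]
    linear_combination (fv f c 0 ^ N * aeval ((fv f c 0)⁻¹ • fv f c) p * fv f c i) * mul_inv_cancel₀ hc

lemma exists_par {Q : Set V4} {S0 : Set ℂ} (hQ0 : Cur Q S0) : ∃ S a b f, Par Q S a b f := by
  obtain ⟨S, a, b, x, u, f', hQ, ha, hb, hx, hxS, hbx, hux, huS, h0', hf'⟩ := rational_param hQ0
  have htr : ∀ p : Polynomial (acl S), p ≠ 0 → Polynomial.aeval u p ≠ 0 := fun p hp h => transcendental_acl huS ⟨p, hp, h⟩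
  obtain ⟨f, h0, hf, hnz⟩ := min_param htr (fun p hp c hc => mem_acl_of_isAlgebraic ⟨p, hp, hc⟩) _ f' rfl h0' hf'
  have hfu : fv f u = (fv f u 0) • x := by
    ext i
    rw [Pi.smul_apply, smul_eq_mul, mul_comm]
    exact (hf i).symm
  have hu0 : fv f u 0 ≠ 0 := htr _ h0
  have hxu : (fv f u 0)⁻¹ • fv f u = x := by
    conv_lhs => rw [hfu]
    rw [smul_smul, Pi.smul_apply, hQ.h0 x hx, smul_eq_mul, mul_one, inv_mul_cancel₀ hu0, one_smul]
  refine ⟨S, a, b, f, hQ, ha, hb, h0, hnz, ?_, ?_, ?_⟩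
  · have h1 : PF1 (acl S) (fun c => lf a (fv f c)) := PF1.comp (lf_pf ha) (fv_pf f)
    have h2 : PF1 (acl S) (fun c => lf b (fv f c)) := PF1.comp (lf_pf hb) (fv_pf f)
    obtain ⟨P, hP⟩ := h1
    obtain ⟨R, hR⟩ := h2
    have h3 : PF1 (acl S) (fun c => lf a (fv f c) - c * lf b (fv f c)) := 
      ⟨P - Polynomial.X * R, fun t => by rw [map_sub, map_mul, Polynomial.aeval_X, ← hP, ← hR]⟩
    intro c
    refine sub_eq_zero.1 (h3.eq_zero huS ?_ c)
    change lf a (fv f u) - u * lf b (fv f u) = 0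
    rw [hfu, lf_smul, lf_smul, hux]; ring
  · intro c hc
    obtain ⟨E, hE1, hE2⟩ := hQ.eqs
    rw [hE2]
    intro g hg
    obtain ⟨p, hp⟩ := hE1 g hg
    obtain ⟨N, R, hR⟩ := clear_den f p
    have hgx : aeval x p = 0 := by rw [← hp]; exact (hE2 x).1 hx g hg
    have hRu := hR u hu0
    rw [hxu, hgx, mul_zero] at hRu
    have hR0 : R = 0 := by
      by_contra h
      exact htr R h hRu.symm
    have := hR c hc
    rw [hR0, map_zero] at this
    rw [hp]
    exact (mul_eq_zero.1 this).resolve_left (pow_ne_zero _ hc)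
  · intro c hc h
    have h2 : PF1 (acl S) (fun c => lf b (fv f c)) := PF1.comp (lf_pf hb) (fv_pf f)
    have := h2.eq_zero hc h u
    change lf b (fv f u) = 0 at this
    rw [hfu, lf_smul] at this
    exact mul_ne_zero hu0 hbx this

/-- normalised point -/
def yv {K : Subfield ℂ} (f : Fin 4 → Polynomial K) (c : ℂ) : V4 := (fv f c 0)⁻¹ • fv f c

section
variable {Q : Set V4} {S : Set ℂ} {a b : V4} {f : Fin 4 → Polynomial (acl S)}

lemma Par.ne0 (h : Par Q S a b f) {c : ℂ} (hc : c ∉ acl S) : fv f c 0 ≠ 0 :=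
  fun h0 => transcendental_acl hc ⟨f 0, h.f0, h0⟩

lemma Par.fv_eq (h : Par Q S a b f) {c : ℂ} (hc : fv f c 0 ≠ 0) : fv f c = fv f c 0 • yv f c := by
  rw [yv, smul_smul, mul_inv_cancel₀ hc, one_smul]

lemma Par.rely (h : Par Q S a b f) (c : ℂ) : lf a (yv f c) = c * lf b (yv f c) := by
  rw [yv, lf_smul, lf_smul, h.rel]; ring

lemma Par.lfb (h : Par Q S a b f) {c : ℂ} (hc : c ∉ acl S) : lf b (yv f c) ≠ 0 := by
  rw [yv, lf_smul]
  exact mul_ne_zero (inv_ne_zero (h.ne0 hc)) (h.hb0 c hc)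

lemma Par.inj (h : Par Q S a b f) {c d : ℂ} (hc : c ∉ acl S) (hd : yv f d = yv f c) : d = c := by
  have h1 := h.rely d
  rw [hd, h.rely c] at h1
  exact (mul_right_cancel₀ (h.lfb hc) h1).symm

lemma Par.mem_of_rat (h : Par Q S a b f) {c : ℂ} (hc : c ∉ acl S) {T : Set ℂ} (hT : S ⊆ T) (hr : Rat T (yv f c)) : c ∈ acl T := by
  have : c = lf a (yv f c) / lf b (yv f c) := by
    rw [h.rely, mul_div_cancel_right₀ _ (h.lfb hc)]
  rw [this]
  exact div_mem (lf_mem (h.ha.mono hT) hr) (lf_mem (h.hb.mono hT) hr)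

lemma Par.not_rat (h : Par Q S a b f) {T : Set ℂ} (hT : S ⊆ T) {c : ℂ} (hc : c ∉ acl T) : ¬ Rat T (yv f c) :=
  fun hr => hc (h.mem_of_rat (fun h' => hc (acl_mono hT h')) hT hr)

lemma exists_notin {T : Set ℂ} (hT : T.Countable) : ∃ c, c ∉ acl T := by
  by_contra h
  push Not at h
  exact not_countable_complex ((acl_countable hT).mono (fun c _ => h c))

lemma rat_span {Q : Set V4} {S : Set ℂ} (hQ : Cur Q S) {y1 y2 y3 v : V4} (h1 : y1 ∈ Q) (h2 : y2 ∈ Q) (h3 : y3 ∈ Q)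
    (i1 : ¬ Rat S y1) (i2 : ¬ Rat (adj S y1) y2) (i3 : ¬ Rat (adj (adj S y1) y2) y3) (hv : Rat S v) {α β γ : ℂ}
    (h : v = α • y1 + β • y2 + γ • y3) : v = 0 := by
  have hγ : γ = 0 := by
    by_contra hγ
    refine notin_span3 ((hQ.adj y1).adj y2) (a := v) (b := y1) (c := y2) (hv.mono ((sub_adj _ _).trans (sub_adj _ _)))
      ((rat_adj _ _).mono (sub_adj _ _)) (rat_adj _ _) h3 i3 γ⁻¹ (-(γ⁻¹ * α)) (-(γ⁻¹ * β)) ?_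
    rw [h]
    ext i; simp only [Pi.add_apply, Pi.smul_apply, smul_eq_mul]; field_simp; ring
  subst hγ
  have hβ : β = 0 := by
    by_contra hγ
    refine notin_span2 (hQ.adj y1) (a := v) (b := y1) (hv.mono (sub_adj _ _))
      (rat_adj _ _) h2 i2 β⁻¹ (-(β⁻¹ * α)) ?_
    rw [h]
    ext i; simp only [Pi.add_apply, Pi.smul_apply, smul_eq_mul]; field_simp; ring
  subst hβ
  have hα : α = 0 := by
    by_contra hγ
    refine notin_span2 hQ (a := v) (b := v) hv hv h1 i1 α⁻¹ 0 ?_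
    rw [h]
    ext i; simp only [Pi.add_apply, Pi.smul_apply, smul_eq_mul]; field_simp; ring
  subst hα
  rw [h]; simp

/-- derivative vector -/
def dv {K : Subfield ℂ} (f : Fin 4 → Polynomial K) : Fin 4 → Polynomial K := fun i => Polynomial.derivative (f i)

lemma fv_rat {T : Set ℂ} {f : Fin 4 → Polynomial (acl S)} (hT : S ⊆ T) {c : ℂ} (hc : c ∈ acl T) : Rat T (fv f c) := by
  intro i
  rw [fv, Polynomial.aeval_eq_sum_range]
  refine sum_mem fun n _ => ?_
  rw [Algebra.smul_def]
  exact mul_mem (acl_mono hT ((f i).coeff n).2) (pow_mem hc n)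

lemma Par.drel (h : Par Q S a b f) (c : ℂ) : lf a (fv (dv f) c) = lf b (fv f c) + c * lf b (fv (dv f) c) := by
  have hs : ∀ (d : V4) (g : Fin 4 → Polynomial (acl S)) (t : ℂ), lf d (fv g t) = (∑ i, Polynomial.C (d i) * (g i).map (algebraMap (acl S) ℂ)).eval t := by
    intro d g t
    rw [Polynomial.eval_finset_sum, lf]
    refine Finset.sum_congr rfl fun i _ => ?_
    rw [Polynomial.eval_mul, Polynomial.eval_C, Polynomial.eval_map_algebraMap, fv]
  set A := ∑ i, Polynomial.C (a i) * (f i).map (algebraMap (acl S) ℂ) with hA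
  set B := ∑ i, Polynomial.C (b i) * (f i).map (algebraMap (acl S) ℂ) with hB
  have hAB : A = Polynomial.X * B := by
    apply Polynomial.funext
    intro t
    rw [Polynomial.eval_mul, Polynomial.eval_X, ← hs, ← hs, h.rel]
  have hd : ∀ d : V4, lf d (fv (dv f) c) = (Polynomial.derivative (∑ i, Polynomial.C (d i) * (f i).map (algebraMap (acl S) ℂ))).eval c := by
    intro d
    rw [hs]
    congr 1
    rw [Polynomial.derivative_sum]
    refine Finset.sum_congr rfl fun i _ => ?_
    rw [Polynomial.derivative_C_mul, Polynomial.derivative_map, dv]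
  rw [hd, hd, ← hA, hAB, hs, ← hB]
  simp

lemma Par.dspan (h : Par Q S a b f) {c : ℂ} (hc : c ∉ acl S) {z w : V4} (hz : z ∈ Q) (hw : w ∈ Q)
    (i2 : ¬ Rat (adj S (yv f c)) z) (i3 : ¬ Rat (adj (adj S (yv f c)) z) w) {α β γ : ℂ}
    (e : fv (dv f) c = α • yv f c + β • z + γ • w) : False := by
  set y := yv f c with hy
  have hr : Rat (adj S y) (fv (dv f) c) := fv_rat (sub_adj _ _) (h.mem_of_rat hc (sub_adj _ _) (rat_adj _ _))
  have hγ : γ = 0 := by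
    by_contra hγ
    refine notin_span3 ((h.cur.adj y).adj z) (a := fv (dv f) c) (b := y) (c := z) (hr.mono (sub_adj _ _))
      ((rat_adj _ _).mono (sub_adj _ _)) (rat_adj _ _) hw i3 γ⁻¹ (-(γ⁻¹ * α)) (-(γ⁻¹ * β)) ?_
    rw [e]
    ext i; simp only [Pi.add_apply, Pi.smul_apply, smul_eq_mul]; field_simp; ring
  subst hγ
  have hβ : β = 0 := by
    by_contra hγ
    refine notin_span2 (h.cur.adj y) (a := fv (dv f) c) (b := y) hr
      (rat_adj _ _) hz i2 β⁻¹ (-(β⁻¹ * α)) ?_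
    rw [e]
    ext i; simp only [Pi.add_apply, Pi.smul_apply, smul_eq_mul]; field_simp; ring
  subst hβ
  have e2 : fv (dv f) c = α • y := by rw [e]; simp
  have := h.drel c
  rw [e2, lf_smul, lf_smul, hy, h.rely] at this
  exact h.hb0 c hc (by linear_combination -this)

lemma dt_lf (y1 y2 y3 : V4) : ∃ k : V4, ∀ v, dt y1 y2 y3 v = lf k v := by
  let L := (Matrix.detRowAlternating (R := ℂ) (n := Fin 4)).toMultilinearMap.toLinearMap ![y1, y2, y3, 0] 3
  have hL : ∀ v, L v = dt y1 y2 y3 v := by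
    intro v
    have : Function.update ![y1, y2, y3, 0] 3 v = ![y1, y2, y3, v] := by
      ext i j
      fin_cases i <;> simp [Function.update]
    change Matrix.det (Function.update ![y1, y2, y3, 0] 3 v) = _
    rw [this]; rfl
  refine ⟨fun i => L (Pi.single i 1), fun v => ?_⟩
  rw [← hL, LinearMap.pi_apply_eq_sum_univ L v, lf]
  refine Finset.sum_congr rfl fun i _ => ?_
  rw [smul_eq_mul, mul_comm]
  congr 2
  ext j; simp [Pi.single_apply, eq_comm]

end


lemma par_final {Q : Set V4} {S : Set ℂ} {a b : V4} {f : Fin 4 → Polynomial (acl S)} (h : Par Q S a b f) :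
    ∃ M : Matrix (Fin 4) (Fin 4) ℂ, M.det ≠ 0 ∧ {c : ℂ | ∃ e : ℂ, e ≠ 0 ∧ e • M.mulVec ![1, c, c ^ 2, c ^ 3] ∈ Q}.Infinite := by
  classical
  have hQ := h.cur
  obtain ⟨u1, hu1⟩ := exists_notin hQ.ctb
  set y1 := yv f u1 with hy1
  obtain ⟨u2, hu2⟩ := exists_notin (hQ.adj y1).ctb
  set y2 := yv f u2 with hy2
  obtain ⟨u3, hu3⟩ := exists_notin ((hQ.adj y1).adj y2).ctb
  set y3 := yv f u3 with hy3
  have hu2' : u2 ∉ acl S := fun h' => hu2 (acl_mono (sub_adj _ _) h')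
  have hu3' : u3 ∉ acl S := fun h' => hu3 (acl_mono ((sub_adj _ _).trans (sub_adj _ _)) h')
  have h1 : y1 ∈ Q := h.mem _ (h.ne0 hu1)
  have h2 : y2 ∈ Q := h.mem _ (h.ne0 hu2')
  have h3 : y3 ∈ Q := h.mem _ (h.ne0 hu3')
  have i1 : ¬ Rat S y1 := h.not_rat subset_rfl hu1
  have i2 : ¬ Rat (adj S y1) y2 := h.not_rat (sub_adj _ _) hu2
  have i3 : ¬ Rat (adj (adj S y1) y2) y3 := h.not_rat ((sub_adj _ _).trans (sub_adj _ _)) hu3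
  have hli : LinearIndependent ℂ ![y1, y2, y3] := by
    refine li3_of (ne_zero_of_mem hQ h1) (fun α e => ?_) (fun α β => notin_span2 ((hQ.adj y1).adj y2) ((rat_adj _ _).mono (sub_adj _ _)) (rat_adj _ _) h3 i3 α β)
    exact notin_span2 (hQ.adj y1) (rat_adj _ _) (rat_adj _ _) h2 i2 α 0 (by rw [e]; simp)
  obtain ⟨k, hk⟩ := dt_lf y1 y2 y3
  let PP : (Fin 4 → Polynomial (acl S)) → Polynomial ℂ := fun g => ∑ i, Polynomial.C (k i) * (g i).map (algebraMap (acl S) ℂ)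
  have hs : ∀ (g : Fin 4 → Polynomial (acl S)) (t : ℂ), (PP g).eval t = dt y1 y2 y3 (fv g t) := by
    intro g t
    rw [Polynomial.eval_finset_sum, hk, lf]
    refine Finset.sum_congr rfl fun i _ => ?_
    rw [Polynomial.eval_mul, Polynomial.eval_C, Polynomial.eval_map_algebraMap, fv]
  have hder : Polynomial.derivative (PP f) = PP (dv f) := by
    simp only [PP]
    rw [Polynomial.derivative_sum]
    refine Finset.sum_congr rfl fun i _ => ?_
    rw [Polynomial.derivative_C_mul, Polynomial.derivative_map, dv]
  have hcoef : ∀ n, (PP f).coeff n = dt y1 y2 y3 (fun i => ((f i).coeff n : ℂ)) := by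
    intro n
    rw [hk, lf, Polynomial.finset_sum_coeff]
    refine Finset.sum_congr rfl fun i _ => ?_
    rw [Polynomial.coeff_C_mul, Polynomial.coeff_map]; rfl
  have hroot : ∀ c, (PP f).eval c = 0 → c = u1 ∨ c = u2 ∨ c = u3 := by
    intro c hc
    rw [hs] at hc
    obtain ⟨α, β, γ, e⟩ := span_of_dt hli hc
    by_cases h0 : fv f c 0 = 0
    · exfalso
      have hcS : c ∈ acl S := mem_acl_of_isAlgebraic ⟨f 0, h.f0, h0⟩
      exact h.nz c (rat_span hQ h1 h2 h3 i1 i2 i3 (fv_rat subset_rfl hcS) e)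
    · have e2 : yv f c = ((fv f c 0)⁻¹ * α) • y1 + ((fv f c 0)⁻¹ * β) • y2 + ((fv f c 0)⁻¹ * γ) • y3 := by
        simp only [yv, mul_smul, ← smul_add, ← e]
      rcases claimA hQ h1 h2 h3 (h.mem c h0) i1 i2 i3 e2 with h' | h' | h'
      · exact Or.inl (h.inj hu1 h')
      · exact Or.inr (Or.inl (h.inj hu2' h'))
      · exact Or.inr (Or.inr (h.inj hu3' h'))
  have hsimp : ∀ c, (PP f).eval c = 0 → (Polynomial.derivative (PP f)).eval c ≠ 0 := by
    intro c hc hd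
    rw [hder, hs] at hd
    obtain ⟨α, β, γ, e⟩ := span_of_dt hli hd
    rcases hroot c hc with rfl | rfl | rfl
    · exact h.dspan hu1 h2 h3 i2 i3 e
    · refine h.dspan hu2' h1 h3 (indep_symm hQ h1 h2 i1 i2).2 (by rw [← hy2, adj_comm]; exact i3) (α := β) (β := α) (γ := γ) ?_
      rw [e, add_comm (α • y1)]
    · have i3' : ¬ Rat (adj S y1) y3 := fun hr => i3 (hr.mono (sub_adj _ _))
      refine h.dspan hu3' h1 h2 (indep_symm hQ h1 h3 i1 i3').2 (by rw [← hy3, adj_comm]; exact (indep_symm (hQ.adj y1) h2 h3 i2 i3).2) (α := γ) (β := α) (γ := β) ?_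
      rw [e]; abel
  have hP0 : PP f ≠ 0 := by
    intro h0
    obtain ⟨c, hc⟩ := (Set.toFinite ({u1, u2, u3} : Set ℂ)).infinite_compl.nonempty
    apply hc
    have := hroot c (by rw [h0, Polynomial.eval_zero])
    simpa using this
  have hdeg : (PP f).natDegree ≤ 3 := by
    rw [← IsAlgClosed.card_roots_eq_natDegree]
    have hnd : (PP f).roots.Nodup := by
      rw [Multiset.nodup_iff_count_le_one]
      intro c
      rw [Polynomial.count_roots]
      by_contra hlt
      obtain ⟨r1, r2⟩ := (Polynomial.one_lt_rootMultiplicity_iff_isRoot hP0).1 (not_le.1 hlt)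
      exact hsimp c r1 r2
    rw [← Multiset.toFinset_card_of_nodup hnd]
    refine (Finset.card_le_card (t := {u1, u2, u3}) ?_).trans Finset.card_le_three
    intro c hc
    rw [Multiset.mem_toFinset, Polynomial.mem_roots hP0] at hc
    simpa using hroot c hc
  have hc0 : ∀ n, 3 < n → ∀ i, (f i).coeff n = 0 := by
    intro n hn i
    have e0 := hcoef n
    rw [Polynomial.coeff_eq_zero_of_natDegree_lt (hdeg.trans_lt hn)] at e0
    obtain ⟨α, β, γ, e⟩ := span_of_dt hli e0.symm
    have := rat_span hQ h1 h2 h3 i1 i2 i3 (fun i => ((f i).coeff n).2) e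
    exact Subtype.ext (congrFun this i)
  let M : Matrix (Fin 4) (Fin 4) ℂ := fun i n => ((f i).coeff n : ℂ)
  have hM : ∀ c, M.mulVec ![1, c, c ^ 2, c ^ 3] = fv f c := by
    intro c
    ext i
    rw [fv, Polynomial.aeval_eq_sum_range' (n := 4) (Nat.lt_succ_of_le (Polynomial.natDegree_le_iff_coeff_eq_zero.2 fun n hn => hc0 n hn i))]
    simp only [Matrix.mulVec, dotProduct, Fin.sum_univ_four, Finset.sum_range_succ, Finset.sum_range_zero, Algebra.smul_def, M]
    simp
    rfl
  refine ⟨M, ?_, ?_⟩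
  · intro hdet
    obtain ⟨v, hv, hvM⟩ := Matrix.exists_vecMul_eq_zero_iff.2 hdet
    obtain ⟨c, hc⟩ := exists_notin (hQ.adj v).ctb
    have hcS : c ∉ acl S := fun h' => hc (acl_mono (sub_adj _ _) h')
    apply linform_ne (hQ.adj v) (rat_adj _ _) hv (h.mem c (h.ne0 hcS)) (h.not_rat (sub_adj _ _) hc)
    change lf v _ = 0
    rw [lf_smul, ← hM]
    have : lf v (M.mulVec ![1, c, c ^ 2, c ^ 3]) = dotProduct v (M.mulVec ![1, c, c ^ 2, c ^ 3]) := rfl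
    rw [this, Matrix.dotProduct_mulVec, hvM, zero_dotProduct, mul_zero]
  · intro hfin
    refine not_countable_complex (((acl_countable hQ.ctb).union hfin.countable).mono fun c _ => ?_)
    by_cases hc : c ∈ acl S
    · exact Or.inl hc
    · right
      refine ⟨(fv f c 0)⁻¹, inv_ne_zero (h.ne0 hc), ?_⟩
      rw [hM]
      exact h.mem c (h.ne0 hc)

lemma cur_final {Q : Set V4} {S : Set ℂ} (hQ : Cur Q S) :
    ∃ M : Matrix (Fin 4) (Fin 4) ℂ, M.det ≠ 0 ∧ {c : ℂ | ∃ e : ℂ, e ≠ 0 ∧ e • M.mulVec ![1, c, c ^ 2, c ^ 3] ∈ Q}.Infinite := by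
  obtain ⟨_, _, _, _, h⟩ := exists_par hQ
  exact par_final h


lemma fin_eqs {X : Set (Pt 3)} (hX : IsAlgSet X) : ∃ T : Finset (MvPolynomial (Fin 4) ℂ), (∀ p ∈ T, ∃ d, p.IsHomogeneous d) ∧
    ∀ (v : V4) (hv : v ≠ 0), Projectivization.mk ℂ v hv ∈ X ↔ ∀ p ∈ T, eval v p = 0 := by
  obtain ⟨S, hS, rfl⟩ := hX
  obtain ⟨T, hT, hspan⟩ := (Submodule.fg_span_iff_fg_span_finset_subset (R := MvPolynomial (Fin 4) ℂ) S).1 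
    (IsNoetherian.noetherian (R := MvPolynomial (Fin 4) ℂ) (Submodule.span (MvPolynomial (Fin 4) ℂ) S))
  refine ⟨T, fun p hp => hS p (hT hp), fun v hv => ?_⟩
  constructor
  · intro h p hp
    exact h p (hT hp) v hv rfl
  · intro h p hp
    obtain ⟨d, hd⟩ := hS p hp
    rw [vanishesAt_mk_hom (r := 3) hd hv]
    have h1 : p ∈ Submodule.span (MvPolynomial (Fin 4) ℂ) (T : Set (MvPolynomial (Fin 4) ℂ)) := by
      rw [← hspan]; exact Submodule.subset_span hp
    have h2 : Submodule.span (MvPolynomial (Fin 4) ℂ) (T : Set (MvPolynomial (Fin 4) ℂ)) ≤ RingHom.ker (eval v) := 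
      Submodule.span_le.2 fun q hq => h q hq
    exact h2 h1

/-- coefficients -/
def cfs (p : MvPolynomial (Fin 4) ℂ) : Set ℂ := Set.range (fun m => coeff m p)

lemma cfs_countable (p : MvPolynomial (Fin 4) ℂ) : (cfs p).Countable := Set.countable_range _

lemma lift_poly {K : Subfield ℂ} {p : MvPolynomial (Fin 4) ℂ} (h : cfs p ⊆ K) : 
    ∃ P : MvPolynomial (Fin 4) K, ∀ v : V4, aeval v P = eval v p := by
  have : p ∈ (MvPolynomial.map (σ := Fin 4) (algebraMap K ℂ)).range := by
    have hh : p ∈ Set.range (MvPolynomial.map (σ := Fin 4) (algebraMap K ℂ)) := by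
      rw [MvPolynomial.mem_range_map_iff_coeffs_subset]
      intro c hc
      obtain ⟨m, -, rfl⟩ := MvPolynomial.mem_coeffs_iff.1 hc
      exact ⟨⟨coeff m p, h ⟨m, rfl⟩⟩, rfl⟩
    exact hh
  obtain ⟨P, rfl⟩ := this
  exact ⟨P, fun v => by rw [aeval_def, eval_map]⟩

/-- the affine cone slice -/
def slice (X : Set (Pt 3)) : Set V4 := {v | v 0 = 1 ∧ ∀ h : v ≠ 0, Projectivization.mk ℂ v h ∈ X}

lemma ne0_of {v : V4} (h : v 0 = 1) : v ≠ 0 := by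
  rintro rfl; simp at h

/-- the point of a vector (junk at zero) -/
def pt (v : V4) : Pt 3 := if h : v = 0 then Projectivization.mk ℂ (Pi.single 0 1) (by intro h; simpa using congrFun h 0) else Projectivization.mk ℂ v h

lemma pt_eq {v : V4} (h : v ≠ 0) : pt v = Projectivization.mk ℂ v h := by rw [pt, dif_neg h]

lemma pt_inj {v w : V4} (hv : v 0 = 1) (hw : w 0 = 1) (h : pt v = pt w) : v = w := by
  rw [pt_eq (ne0_of hv), pt_eq (ne0_of hw)] at h
  obtain ⟨a, ha, e⟩ := smul_rep (r := 3) _ _ h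
  have := congrFun e 0
  rw [Pi.smul_apply, hv, hw, smul_eq_mul, mul_one] at this
  rw [e, ← this, one_smul]

lemma slice_pt {X : Set (Pt 3)} {v : V4} (h : v ∈ slice X) : pt v ∈ X := by
  rw [pt_eq (ne0_of h.1)]; exact h.2 _

lemma exists_homog (P : MvPolynomial (Fin 4) ℂ) : ∃ (G : MvPolynomial (Fin 4) ℂ) (d : ℕ), G.IsHomogeneous d ∧ ∀ v : V4, v 0 = 1 → eval v G = eval v P := by
  refine ⟨∑ i ∈ Finset.range (P.totalDegree + 1), X 0 ^ (P.totalDegree - i) * homogeneousComponent i P, P.totalDegree, ?_, ?_⟩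
  · refine IsHomogeneous.sum _ _ _ fun i hi => ?_
    have h1 := (isHomogeneous_X_pow (R := ℂ) (0 : Fin 4) (P.totalDegree - i)).mul (homogeneousComponent_isHomogeneous i P)
    rwa [Nat.sub_add_cancel (Nat.lt_succ_iff.1 (Finset.mem_range.1 hi))] at h1
  · intro v hv
    conv_rhs => rw [← sum_homogeneousComponent P]
    rw [map_sum, map_sum]
    refine Finset.sum_congr rfl fun i _ => ?_
    rw [map_mul, map_pow, eval_X, hv, one_pow, one_mul]

lemma lform_hom (a : V4) : (∑ i, C (a i) * X i : MvPolynomial (Fin 4) ℂ).IsHomogeneous 1 :=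
  IsHomogeneous.sum _ _ _ fun i _ => isHomogeneous_C_mul_X _ _

lemma lform_eval (a v : V4) : eval v (∑ i, C (a i) * X i : MvPolynomial (Fin 4) ℂ) = lf a v := by
  simp [lf]

lemma nondeg_form {X : Set (Pt 3)} (h : Nondeg X) {a : V4} (ha : ∀ (v : V4) (hv : v ≠ 0), Projectivization.mk ℂ v hv ∈ X → lf a v = 0) : a = 0 := by
  let L : V4 →ₗ[ℂ] ℂ := { toFun := lf a, map_add' := lf_add a, map_smul' := fun c v => lf_smul a v c }
  have h1 : projSpan X ≤ LinearMap.ker L := by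
    refine iSup₂_le fun x hx => ?_
    induction x using Projectivization.ind with | h v hv =>
    rw [Projectivization.submodule_mk, Submodule.span_singleton_le_iff_mem]
    exact ha v hv hx
  have h2 : ∀ v, L v = 0 := by
    intro v
    have : v ∈ projSpan X := by rw [show projSpan X = ⊤ from h]; trivial
    exact h1 this
  ext i
  have := h2 (Pi.single i 1)
  simpa [L, lf, Pi.single_apply] using this

lemma X_inf {X : Set (Pt 3)} (hX : IsIrrVar X) (h : Nondeg X) : X.Infinite := by
  intro hf
  obtain ⟨x, rfl⟩ := irr_finite hX hf
  have h1 : projSpan {x} = x.submodule := by simp [projSpan]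
  have h2 := x.finrank_submodule
  rw [← h1, show projSpan {x} = ⊤ from h, finrank_top] at h2
  simp at h2

section
variable {X : Set (Pt 3)} 

lemma slice_inf (hX : IsIrrVar X) (hd : ¬ DimGE X 2) (hn : Nondeg X) : (slice X).Infinite := by
  have h0 : (X ∩ {x | VanishesAt (MvPolynomial.X 0 : MvPolynomial (Fin 4) ℂ) x}).Finite := by
    by_contra hinf
    have hs := infinite_subset hX hd (isAlgSet_vanishes (r := 3) _) hinf
    have : (Pi.single 0 1 : V4) = 0 := nondeg_form hn (by
      intro v hv hvX
      have := hs hvX v hv rfl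
      rw [eval_X] at this
      simp [lf, Pi.single_apply, this])
    simpa using congrFun this 0
  have h1 := (X_inf hX hn).diff h0
  refine Set.Infinite.of_image pt (h1.mono ?_)
  rintro x ⟨hx, hx'⟩
  induction x using Projectivization.ind with | h v hv =>
  have hv0 : v 0 ≠ 0 := by
    intro h
    apply hx'
    refine ⟨hx, ?_⟩
    exact (vanishesAt_mk_hom (r := 3) (isHomogeneous_X ℂ 0) hv).2 (by rw [eval_X]; exact h)
  have e1 : ((v 0)⁻¹ • v : V4) ≠ 0 := smul_ne_zero (inv_ne_zero hv0) hv
  have e2 : Projectivization.mk ℂ ((v 0)⁻¹ • v : V4) e1 = Projectivization.mk ℂ v hv := by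
    rw [Projectivization.mk_eq_mk_iff']
    exact ⟨(v 0)⁻¹, rfl⟩
  refine ⟨(v 0)⁻¹ • v, ⟨by simp [hv0], fun h => by rw [e2]; exact hx⟩, ?_⟩
  rw [pt_eq e1, e2]

lemma slice_ext (hX : IsIrrVar X) (hd : ¬ DimGE X 2) {Y : Set (Pt 3)} (hY : IsAlgSet Y) {R : Set V4} (hR : R.Infinite) 
    (hRX : R ⊆ slice X) (h : ∀ v ∈ R, pt v ∈ Y) : X ⊆ Y := by
  refine infinite_subset hX hd hY (Set.infinite_of_injOn_mapsTo (f := pt) (s := R) ?_ ?_ hR)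
  · intro v hv w hw e
    exact pt_inj (hRX hv).1 (hRX hw).1 e
  · intro v hv
    exact ⟨slice_pt (hRX hv), h v hv⟩

lemma slice_ext_poly (hX : IsIrrVar X) (hd : ¬ DimGE X 2) (hn : Nondeg X) (G : MvPolynomial (Fin 4) ℂ) 
    (h : ∀ v ∈ slice X, ∀ a : ℂ, eval (a • v) G = 0) (v : V4) (hv : v ≠ 0) (hvX : Projectivization.mk ℂ v hv ∈ X) : eval v G = 0 := by
  have := slice_ext hX hd (isAlgSet_vanishes (r := 3) G) (slice_inf hX hd hn) subset_rfl (by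
    intro w hw
    rw [pt_eq (ne0_of hw.1)]
    exact (vanishesAt_mk (r := 3) _).2 fun a _ => h w hw a)
  exact this hvX v hv rfl

lemma slice_zinf (hX : IsIrrVar X) (hd : ¬ DimGE X 2) (P : MvPolynomial (Fin 4) ℂ) 
    (hinf : {v | v ∈ slice X ∧ eval v P = 0}.Infinite) : ∀ v ∈ slice X, eval v P = 0 := by
  obtain ⟨G, d, hG, hGP⟩ := exists_homog P
  have := slice_ext hX hd (isAlgSet_vanishes (r := 3) G) hinf (fun v hv => hv.1) (by
    rintro w ⟨hw, hw0⟩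
    rw [pt_eq (ne0_of hw.1)]
    exact (vanishesAt_mk_hom (r := 3) hG _).2 (by rw [hGP w hw.1, hw0]))
  intro v hv
  rw [← hGP v hv.1]
  exact this (hv.2 (ne0_of hv.1)) v _ rfl

lemma sec_all (hX : IsIrrVar X) (hd : ¬ DimGE X 2) (hn : Nondeg X) {h : MvPolynomial (Fin 4) ℂ} {d : ℕ} (hh : h.IsHomogeneous d)
    (h0 : ∀ x ∈ slice X, ∀ y ∈ slice X, ∀ t : ℂ, eval (x + t • y) h = 0) :
    SecVar X ⊆ {x | VanishesAt h x} := by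
  let G : V4 → MvPolynomial (Fin 4) ℂ := fun w => MvPolynomial.aeval (fun i => MvPolynomial.X i + MvPolynomial.C (w i)) h
  have hG : ∀ w v, eval v (G w) = eval (v + w) h := by
    intro w v
    have ev : ∀ (z : V4) (p : MvPolynomial (Fin 4) ℂ), eval z p = (aeval z : MvPolynomial (Fin 4) ℂ →ₐ[ℂ] ℂ) p := 
      fun z p => (DFunLike.congr_fun (coe_aeval_eq_eval z) p).symm
    rw [ev, ev, ← AlgHom.comp_apply, MvPolynomial.comp_aeval]
    congr 2
    ext i
    simp
  have s1 : ∀ y ∈ slice X, ∀ t : ℂ, ∀ (v : V4) (hv : v ≠ 0), Projectivization.mk ℂ v hv ∈ X → eval (v + t • y) h = 0 := by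
    intro y hy t v hv hvX
    rw [← hG]
    refine slice_ext_poly hX hd hn _ ?_ v hv hvX
    intro x hx a
    rw [hG]
    by_cases ha : a = 0
    · have e : (a • x + t • y : V4) = t • (y + (0 : ℂ) • y) := by rw [ha]; simp
      rw [e, eval_smul_hom (r := 3) hh, h0 y hy y hy, mul_zero]
    · have e : (a • x + t • y : V4) = a • (x + (a⁻¹ * t) • y) := by
        rw [smul_add, smul_smul, mul_inv_cancel_left₀ ha]
      rw [e, eval_smul_hom (r := 3) hh, h0 x hx y hy, mul_zero]
  have s2 : ∀ (w : V4) (hw : w ≠ 0), Projectivization.mk ℂ w hw ∈ X → ∀ (v : V4) (hv : v ≠ 0), Projectivization.mk ℂ v hv ∈ X → eval (v + w) h = 0 := by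
    intro w hw hwX v hv hvX
    rw [← hG]
    refine slice_ext_poly hX hd hn _ ?_ v hv hvX
    intro y hy a
    rw [hG, add_comm]
    exact s1 y hy a w hw hwX
  have smk : ∀ (v : V4) (hv : v ≠ 0) (a : ℂ) (ha : a • v ≠ 0), Projectivization.mk ℂ v hv ∈ X → Projectivization.mk ℂ (a • v) ha ∈ X := by
    intro v hv a ha hvX
    have : Projectivization.mk ℂ (a • v) ha = Projectivization.mk ℂ v hv := by
      rw [Projectivization.mk_eq_mk_iff']
      exact ⟨a, rfl⟩
    rwa [this]
  have s3 : ∀ (v : V4) (hv : v ≠ 0), Projectivization.mk ℂ v hv ∈ X → eval v h = 0 := by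
    intro v hv hvX
    have h2 : ((2 : ℂ)⁻¹ • v : V4) ≠ 0 := smul_ne_zero (by norm_num) hv
    have := s2 _ h2 (smk v hv _ h2 hvX) _ h2 (smk v hv _ h2 hvX)
    rwa [← add_smul, show (2 : ℂ)⁻¹ + 2⁻¹ = 1 by norm_num, one_smul] at this
  refine Set.sInter_subset_of_mem ⟨isAlgSet_vanishes (r := 3) h, ?_⟩
  rintro p ⟨L, ⟨x, hx, y, hy, hxy, rfl⟩, hp⟩
  induction x using Projectivization.ind with | h v hv =>
  induction y using Projectivization.ind with | h w hw =>
  induction p using Projectivization.ind with | h q hq =>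
  refine (vanishesAt_mk_hom (r := 3) hh hq).2 ?_
  have hp' : (Projectivization.mk ℂ q hq).submodule ≤ (Projectivization.mk ℂ v hv).submodule ⊔ (Projectivization.mk ℂ w hw).submodule := hp
  rw [Projectivization.submodule_mk, Projectivization.submodule_mk, Projectivization.submodule_mk, Submodule.span_singleton_le_iff_mem,
    ← Submodule.span_union, Set.singleton_union, Submodule.mem_span_pair] at hp'
  obtain ⟨α, β, rfl⟩ := hp'
  by_cases hα : α • v = 0
  · by_cases hβ : β • w = 0
    · rw [hα, hβ] at hq; simp at hq
    · rw [hα, zero_add]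
      exact s3 _ hβ (smk w hw _ hβ hy)
  · by_cases hβ : β • w = 0
    · rw [hβ, add_zero]
      exact s3 _ hα (smk v hv _ hα hx)
    · exact s2 _ hβ (smk w hw _ hβ hy) _ hα (smk v hv _ hα hx)

end


lemma exists_cur {X : Set (Pt 3)} (hX : IsIrrVar X) (hd : ¬ DimGE X 2) (hn : Nondeg X) (hsec : SecVar X = Set.univ)
    (hg : Generic Set.univ (fun p => ∃! L : Set (Pt 3), SecLine X L ∧ p ∈ L)) : ∃ S0, Cur (slice X) S0 := by
  obtain ⟨T, hT, hTX⟩ := fin_eqs hX.2.1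
  obtain ⟨A, ⟨SA, hSA, rfl⟩, hA1, hA2⟩ := hg
  obtain ⟨p0, -, hp0⟩ := Set.not_subset.1 hA1
  obtain ⟨h0, hh0, hv0⟩ : ∃ h0 ∈ SA, ¬ VanishesAt h0 p0 := by
    by_contra hcon
    push Not at hcon
    exact hp0 hcon
  obtain ⟨d, hd0⟩ := hSA h0 hh0
  refine ⟨(⋃ p ∈ T, cfs p) ∪ cfs h0, ?_, ?_, ?_, ?_, ?_, ?_, ?_⟩
  · intro v hv; exact hv.1
  · exact (T.countable_toSet.biUnion fun p _ => cfs_countable p).union (cfs_countable h0)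
  · refine ⟨{g | (g = fun v : V4 => v 0 - 1) ∨ ∃ p ∈ T, g = fun v => eval v p}, ?_, ?_⟩
    · rintro g (rfl | ⟨p, hp, rfl⟩)
      · exact ⟨MvPolynomial.X 0 - 1, fun v => by simp⟩
      · obtain ⟨P, hP⟩ := lift_poly (K := acl ((⋃ p ∈ T, cfs p) ∪ cfs h0)) (p := p) (by
          refine Set.Subset.trans ?_ (subset_acl _)
          exact fun z hz => Or.inl (Set.mem_biUnion hp hz))
        exact ⟨P, fun v => (hP v).symm⟩
    · intro v
      constructor
      · rintro hv g (rfl | ⟨p, hp, rfl⟩)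
        · simp [hv.1]
        · exact (hTX v (ne0_of hv.1)).1 (hv.2 _) p hp
      · intro h
        have e1 : v 0 = 1 := sub_eq_zero.1 (h _ (Or.inl rfl))
        exact ⟨e1, fun hv => (hTX v hv).2 fun p hp => h _ (Or.inr ⟨p, hp, rfl⟩)⟩
  · exact slice_zinf hX hd
  · exact slice_inf hX hd hn
  · intro a ha
    refine nondeg_form hn fun v hv hvX => ?_
    rw [← lform_eval]
    refine slice_ext_poly hX hd hn _ ?_ v hv hvX
    intro w hw c
    rw [lform_eval, lf_smul, lf, ha w hw, mul_zero]
  · obtain ⟨h, hh⟩ := lift_poly (K := acl ((⋃ p ∈ T, cfs p) ∪ cfs h0)) (p := h0) (by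
      refine Set.Subset.trans ?_ (subset_acl _)
      exact fun z hz => Or.inr hz)
    refine ⟨h, ?_, ?_⟩
    · by_contra hcon
      push Not at hcon
      apply hv0
      refine sec_all hX hd hn hd0 ?_ (by rw [hsec]; trivial : p0 ∈ SecVar X)
      intro x hx y hy t
      rw [← hh]
      exact hcon x hx y hy t
    · intro x1 h1 x2 h2 x3 h3 x4 h4 h12 h34 t a b hne e
      rw [hh] at hne
      have n1 := ne0_of h1.1
      have n2 := ne0_of h2.1
      have n3 := ne0_of h3.1
      have n4 := ne0_of h4.1
      have hp : x1 + t • x2 ≠ 0 := by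
        intro h
        have e0 := congrFun h 0
        simp only [Pi.add_apply, Pi.smul_apply, h1.1, h2.1, smul_eq_mul, mul_one, Pi.zero_apply] at e0
        have : t = -1 := by linear_combination e0
        rw [this, neg_one_smul, ← sub_eq_add_neg, sub_eq_zero] at h
        exact h12 h
      have hnA : Projectivization.mk ℂ (x1 + t • x2) hp ∉ ZeroLocus SA := by
        intro h
        exact hne ((h h0 hh0) _ hp rfl)
      have hne12 : Projectivization.mk ℂ x1 n1 ≠ Projectivization.mk ℂ x2 n2 := by
        rw [← pt_eq n1, ← pt_eq n2]
        exact fun h => h12 (pt_inj h1.1 h2.1 h)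
      have hne34 : Projectivization.mk ℂ x3 n3 ≠ Projectivization.mk ℂ x4 n4 := by
        rw [← pt_eq n3, ← pt_eq n4]
        exact fun h => h34 (pt_inj h3.1 h4.1 h)
      have hmem : ∀ (u v w : V4) (hu : u ≠ 0) (hv : v ≠ 0) (hw : w ≠ 0),
          Projectivization.mk ℂ u hu ∈ lineThrough (r := 3) (Projectivization.mk ℂ v hv) (Projectivization.mk ℂ w hw) ↔ ∃ c d : ℂ, c • v + d • w = u := by
        intro u v w hu hv hw
        have : Projectivization.mk ℂ u hu ∈ lineThrough (r := 3) (Projectivization.mk ℂ v hv) (Projectivization.mk ℂ w hw) ↔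
          (Projectivization.mk ℂ u hu).submodule ≤ (Projectivization.mk ℂ v hv).submodule ⊔ (Projectivization.mk ℂ w hw).submodule := Iff.rfl
        rw [this, Projectivization.submodule_mk, Projectivization.submodule_mk, Projectivization.submodule_mk, Submodule.span_singleton_le_iff_mem,
          ← Submodule.span_union, Set.singleton_union, Submodule.mem_span_pair]
      have hu := (hA2 _ ⟨trivial, hnA⟩).unique
        ⟨⟨_, h1.2 n1, _, h2.2 n2, hne12, rfl⟩, (hmem _ _ _ _ _ _).2 ⟨1, t, by rw [one_smul]⟩⟩
        ⟨⟨_, h3.2 n3, _, h4.2 n4, hne34, rfl⟩, (hmem _ _ _ _ _ _).2 ⟨a, b, e.symm⟩⟩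
      have h3m := (hmem x3 x3 x4 n3 n3 n4).2 ⟨1, 0, by simp⟩
      rw [← hu, hmem] at h3m
      obtain ⟨c, d, hcd⟩ := h3m
      exact ⟨c, d, hcd.symm⟩

lemma isAlgSet_preimage {Y : Set (Pt 3)} (hY : IsAlgSet Y) (g : V4 ≃ₗ[ℂ] V4) :
    IsAlgSet {p : Pt 3 | Projectivization.map (g : V4 →ₗ[ℂ] V4) g.injective p ∈ Y} := by
  obtain ⟨S, hS, rfl⟩ := hY
  let F : MvPolynomial (Fin 4) ℂ →ₐ[ℂ] MvPolynomial (Fin 4) ℂ := 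
    MvPolynomial.aeval (fun i => ∑ j, C (g (Pi.single j 1) i) * X j)
  have ev : ∀ (z : V4) (p : MvPolynomial (Fin 4) ℂ), eval z p = (aeval z : MvPolynomial (Fin 4) ℂ →ₐ[ℂ] ℂ) p := 
    fun z p => (DFunLike.congr_fun (coe_aeval_eq_eval z) p).symm
  have hF : ∀ p v, eval v (F p) = eval (g v) p := by
    intro p v
    rw [ev, ev, ← AlgHom.comp_apply, MvPolynomial.comp_aeval]
    congr 2
    ext i
    have := congrFun (LinearMap.pi_apply_eq_sum_univ (g : V4 →ₗ[ℂ] V4) v) i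
    change g v i = _ at this
    rw [this]
    simp only [map_sum, map_mul, aeval_X, aeval_C, Finset.sum_apply, Pi.smul_apply, smul_eq_mul]
    refine Finset.sum_congr rfl fun j _ => ?_
    rw [mul_comm]
    congr 1
    refine congrArg (fun w : V4 => g w i) ?_
    ext k; simp [Pi.single_apply, eq_comm]
  have hFh : ∀ p d, p.IsHomogeneous d → (F p).IsHomogeneous d := by
    intro p d hp
    have := hp.aeval (fun i => ∑ j, C (g (Pi.single j 1) i) * X j) (n := 1) (fun i => lform_hom _)
    rwa [one_mul] at this
  refine ⟨F '' S, ?_, ?_⟩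
  · rintro _ ⟨p, hp, rfl⟩
    obtain ⟨d, hd⟩ := hS p hp
    exact ⟨d, hFh p d hd⟩
  · ext x
    induction x using Projectivization.ind with | h v hv =>
    have hgv : g v ≠ 0 := by simpa using hv
    have hm : Projectivization.map (g : V4 →ₗ[ℂ] V4) g.injective (Projectivization.mk ℂ v hv) = Projectivization.mk ℂ (g v) hgv := 
      Projectivization.map_mk _ _ _ _
    simp only [Set.mem_setOf_eq, hm, ZeroLocus, Set.forall_mem_image]
    refine forall₂_congr fun p hp => ?_
    obtain ⟨d, hd⟩ := hS p hp
    rw [vanishesAt_mk_hom (r := 3) hd, vanishesAt_mk_hom (r := 3) (hFh p d hd), hF]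

lemma finish {X : Set (Pt 3)} (hX : IsIrrVar X) (hd : ¬ DimGE X 2) {M : Matrix (Fin 4) (Fin 4) ℂ} (hM : M.det ≠ 0)
    (hinf : {c : ℂ | ∃ e : ℂ, e ≠ 0 ∧ e • M.mulVec ![1, c, c ^ 2, c ^ 3] ∈ slice X}.Infinite) : IsRationalNormalCubic X := by
  have hu : IsUnit M.det := isUnit_iff_ne_zero.2 hM
  let e : V4 ≃ₗ[ℂ] V4 := Matrix.toLin'OfInv (Matrix.nonsing_inv_mul M hu) (Matrix.mul_nonsing_inv M hu)
  have he : ∀ v, e v = M.mulVec v := fun v => Matrix.toLin'_apply M v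
  have hen : ∀ v : V4, v ≠ 0 → e v ≠ 0 := fun v hv => by simpa using hv
  have hX1 : ∀ c : ℂ, (![1, c, c ^ 2, c ^ 3] : V4) ≠ 0 := fun c h => by simpa using congrFun h 0
  obtain ⟨T, hT, hTX⟩ := fin_eqs hX.2.1
  have hinf2 : ∀ c ∈ {c : ℂ | ∃ e : ℂ, e ≠ 0 ∧ e • M.mulVec ![1, c, c ^ 2, c ^ 3] ∈ slice X}, 
      Projectivization.mk ℂ (e ![1, c, c ^ 2, c ^ 3]) (hen _ (hX1 c)) ∈ X := by
    rintro c ⟨k, hk, hk2⟩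
    have h1 := hk2.2 (ne0_of hk2.1)
    have h2 : Projectivization.mk ℂ (k • M.mulVec ![1, c, c ^ 2, c ^ 3]) (ne0_of hk2.1) = Projectivization.mk ℂ (e ![1, c, c ^ 2, c ^ 3]) (hen _ (hX1 c)) := by
      rw [Projectivization.mk_eq_mk_iff']
      exact ⟨k, rfl⟩
    rwa [h2] at h1
  have hpoly : ∀ p : MvPolynomial (Fin 4) ℂ, PF (⊤ : Subfield ℂ) (fun v => eval (e v) p) := by
    intro p
    obtain ⟨P, hP⟩ := lift_poly (K := (⊤ : Subfield ℂ)) (p := p) (fun z _ => trivial)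
    have h1 : PF (⊤ : Subfield ℂ) (fun v => eval v p) := ⟨P, fun v => (hP v).symm⟩
    refine PF.comp h1 (w := fun v => e v) fun i => ?_
    simp only [he, Matrix.mulVec, dotProduct]
    exact PF.sum _ fun j => (PF.const (K := (⊤ : Subfield ℂ)) (c := M i j) trivial).mul (PF.coord _ _)
  have key : ∀ p ∈ T, ∀ s t : ℂ, eval (e ![s ^ 3, s ^ 2 * t, s * t ^ 2, t ^ 3]) p = 0 := by
    intro p hp
    obtain ⟨d, hd⟩ := hT p hp
    have i0 := PF1.id (⊤ : Subfield ℂ)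
    have i1 : PF1 (⊤ : Subfield ℂ) (fun _ => (1 : ℂ)) := PF1.const trivial
    have i2 : PF1 (⊤ : Subfield ℂ) (fun t => t ^ 2) := by simpa only [pow_two] using i0.mul i0
    have i3 : PF1 (⊤ : Subfield ℂ) (fun t => t ^ 3) := by simpa only [pow_succ, pow_zero, one_mul] using (i0.mul i0).mul i0
    have k1 : ∀ c : ℂ, eval (e ![1, c, c ^ 2, c ^ 3]) p = 0 := by
      have hpf : PF1 (⊤ : Subfield ℂ) (fun c : ℂ => eval (e ![1, c, c ^ 2, c ^ 3]) p) := by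
        refine PF1.comp (hpoly p) (w := fun c => ![1, c, c ^ 2, c ^ 3]) fun i => ?_
        fin_cases i
        exacts [i1, i0, i2, i3]
      exact hpf.eq_zero_inf (hinf.mono fun c hc => (hTX _ (hen _ (hX1 c))).1 (hinf2 c hc) p hp)
    have k2 : ∀ s t : ℂ, s ≠ 0 → eval (e ![s ^ 3, s ^ 2 * t, s * t ^ 2, t ^ 3]) p = 0 := by
      intro s t hs
      have : (![s ^ 3, s ^ 2 * t, s * t ^ 2, t ^ 3] : V4) = (s ^ 3) • ![1, t / s, (t / s) ^ 2, (t / s) ^ 3] := by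
        ext i
        fin_cases i <;> simp <;> field_simp
      rw [this, map_smul, eval_smul_hom (r := 3) hd, k1, mul_zero]
    intro s t
    by_cases hs : s = 0
    · have hpf : PF1 (⊤ : Subfield ℂ) (fun s : ℂ => eval (e ![s ^ 3, s ^ 2 * t, s * t ^ 2, t ^ 3]) p) := by
        refine PF1.comp (hpoly p) (w := fun s => ![s ^ 3, s ^ 2 * t, s * t ^ 2, t ^ 3]) fun i => ?_
        fin_cases i
        exacts [i3, i2.mul (PF1.const trivial), i0.mul (PF1.const trivial), PF1.const trivial]
      refine hpf.eq_zero_inf ((Set.finite_singleton (0 : ℂ)).infinite_compl.mono fun c hc => ?_) s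
      exact k2 c t hc
    · exact k2 s t hs
  have hmap : ∀ (v : V4) (hv : v ≠ 0) (g : V4 ≃ₗ[ℂ] V4) (hgv : g v ≠ 0), Projectivization.map (g : V4 →ₗ[ℂ] V4) g.injective (Projectivization.mk ℂ v hv) = Projectivization.mk ℂ (g v) hgv := 
    fun v hv g hgv => Projectivization.map_mk _ _ _ _
  refine ⟨e.symm, ?_⟩
  apply Set.Subset.antisymm
  · intro p hp
    have h1 := hp {p | Projectivization.map (e : V4 →ₗ[ℂ] V4) e.injective p ∈ X} ⟨isAlgSet_preimage hX.2.1 e, by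
      rintro p ⟨s, t, hst, rfl⟩
      change Projectivization.map (e : V4 →ₗ[ℂ] V4) e.injective _ ∈ X
      rw [hmap _ _ _ (hen _ hst), hTX]
      exact fun p hp => key p hp s t⟩
    refine ⟨_, h1, ?_⟩
    induction p using Projectivization.ind with | h v hv =>
    rw [hmap _ hv _ (hen v hv)]
    refine (hmap _ (hen v hv) e.symm (by simpa using hv)).trans ?_
    congr 1
    exact e.symm_apply_apply v
  · rintro _ ⟨p, hp, rfl⟩
    rintro Y ⟨hY, hYs⟩
    have hsub : X ⊆ {p | Projectivization.map (e.symm : V4 →ₗ[ℂ] V4) e.symm.injective p ∈ Y} := by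
      refine infinite_subset hX hd (isAlgSet_preimage hY e.symm) ?_
      refine Set.infinite_of_injOn_mapsTo (f := fun c : ℂ => Projectivization.mk ℂ (e ![1, c, c ^ 2, c ^ 3]) (hen _ (hX1 c))) ?_ ?_ hinf
      · intro c _ c' _ h
        obtain ⟨a, ha, h2⟩ := smul_rep (r := 3) _ _ h
        have h3 : (![1, c, c ^ 2, c ^ 3] : V4) = a • ![1, c', c' ^ 2, c' ^ 3] := by
          apply e.injective
          rw [map_smul]; exact h2
        have h4 := congrFun h3 0
        have h5 := congrFun h3 1
        simp at h4 h5
        rw [h5, ← h4, one_mul]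
      · intro c hc
        refine ⟨hinf2 c hc, ?_⟩
        apply hYs
        refine ⟨1, c, by simp, ?_⟩
        refine (hmap _ (hen _ (hX1 c)) e.symm (by simp)).trans ?_
        congr 1
        rw [e.symm_apply_apply]
        simp
    exact hsub hp

theorem oadp_curves_are_twisted_cubics (X : Set (Pt (2 * 1 + 1))) (hX : IsOADP 1 X) : IsRationalNormalCubic X := by
  obtain ⟨⟨h1, ⟨-, h2⟩, h3⟩, h4, h5⟩ := hX
  obtain ⟨S, hS⟩ := exists_cur (X := X) h1 h2 h3 h4 h5
  obtain ⟨M, hM, hinf⟩ := cur_final hS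
  exact finish (X := X) h1 h2 hM hinf

end ProjGeo
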